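/- (Bilinear estimate with decay between different fiber-length scales.) Assume BH(s,r) holds for some 3/2 < s < 2 and r < s'. With Ω ⊆ [0,1]², the sets Ω(K), the collection 𝓚(ε), and the near-tile pieces Ω_δ(K) as in the decoupling setup, suppose in addition that 𝓚 ⊆ 𝓚(ε) is such that both 𝓚 and {J(K) : K ∈ 𝓚} are A log δ^{-1}-separated for a sufficiently large admissible constant A. Then there is an admissible constant c₀ > 0 such that for all K, K' ∈ 𝓚, ∥𝓔χ_{Ω_δ(K)} · 𝓔χ_{Ω_δ(K')}∥_{L^s(ℝ³)} ≲ 2^{-c₀|K−K'|} · max{|Ω(K)|, |Ω(K')|}^{2/s'}. -/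

import Mathlib

open MeasureTheory Set
open scoped ENNReal

/-- The extension operator for the hyperbolic paraboloid `τ = ξ₁ξ₂` in `ℝ³`:
`𝓔f(t,x) = ∫_{ℝ²} e^{i(tξ₁ξ₂ + x·ξ)} f(ξ) dξ`. -/
noncomputable def extOp (f : ℝ × ℝ → ℂ) (p : ℝ × ℝ × ℝ) : ℂ :=
  ∫ ξ : ℝ × ℝ,
    Complex.exp (Complex.I * (p.1 * ξ.1 * ξ.2 + p.2.1 * ξ.1 + p.2.2 * ξ.2 : ℝ)) * f ξ

/-- Characteristic function of a set, valued in `ℂ`. -/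
noncomputable def chi (Ω : Set (ℝ × ℝ)) : ℝ × ℝ → ℂ := Ω.indicator fun _ => 1

/-- The axis-parallel unit square with lower-left corner `(a, b)`. -/
def unitSq (a b : ℝ) : Set (ℝ × ℝ) := Icc a (a + 1) ×ˢ Icc b (b + 1)

/-- Bilinear hypothesis BH(s,r) with constant `A`: a bilinear adjoint restriction estimate
`∥𝓔f·𝓔g∥_{L^s} ≤ A ∥f∥_{L^r} ∥g∥_{L^r}` whenever `f, g` are supported in `1 × 1`
axis-parallel squares whose projections onto each coordinate axis are separated by a
distance between `1` and `4` (equivalently, the corners satisfy `2 ≤ |aᵢ - bᵢ| ≤ 5`). -/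
def BH (s r A : ℝ) : Prop :=
  ∀ a₁ a₂ b₁ b₂ : ℝ, 2 ≤ |a₁ - b₁| → |a₁ - b₁| ≤ 5 → 2 ≤ |a₂ - b₂| → |a₂ - b₂| ≤ 5 →
    ∀ f g : ℝ × ℝ → ℂ,
      Function.support f ⊆ unitSq a₁ a₂ → Function.support g ⊆ unitSq b₁ b₂ →
      eLpNorm (fun p => extOp f p * extOp g p) (ENNReal.ofReal s) volume ≤
        ENNReal.ofReal A * eLpNorm f (ENNReal.ofReal r) volume *
          eLpNorm g (ENNReal.ofReal r) volume


/-- The dyadic interval `[m·2⁻ⁿ, (m+1)·2⁻ⁿ]`. -/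
def dyadicIcc (n m : ℤ) : Set ℝ := Icc ((m : ℝ) * 2 ^ (-n)) (((m : ℝ) + 1) * 2 ^ (-n))

/-- A tile in `𝓓_{j,k}`: a product of a dyadic interval of length `2⁻ʲ` with one of
length `2⁻ᵏ`. -/
def tile (j k m m' : ℤ) : Set (ℝ × ℝ) := dyadicIcc j m ×ˢ dyadicIcc k m'

/-- A dyadic number is one of the form `2ⁿ`, `n ∈ ℤ`. -/
def IsDyadic (x : ℝ) : Prop := ∃ n : ℤ, x = 2 ^ n

/-- The vertical fiber of `Ω ⊆ ℝ²` over `x`: `{η : (x, η) ∈ Ω}`. -/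
def vFiber (Ω : Set (ℝ × ℝ)) (x : ℝ) : Set ℝ := {y | (x, y) ∈ Ω}

/-- `Ω(K) = {ξ ∈ Ω : 2^{-K-1} ≤ 𝓗¹({η : (ξ₁,η) ∈ Ω}) ≤ 2^{-K+1}}`, the piece of `Ω` whose
vertical fibers have length about `2⁻ᴷ`. -/
noncomputable def fiberPiece (Ω : Set (ℝ × ℝ)) (K : ℕ) : Set (ℝ × ℝ) :=
  {ξ ∈ Ω | (2 : ℝ≥0∞) ^ (-(K : ℤ) - 1) ≤ volume (vFiber Ω ξ.1) ∧
    volume (vFiber Ω ξ.1) ≤ (2 : ℝ≥0∞) ^ (-(K : ℤ) + 1)}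

/-- `VargasBound s Ω c` says `∥𝓔χ_{Ω'}∥_{L^{2s}} ≤ c·|Ω|^{1/s'}` for every measurable
`Ω' ⊆ Ω` (here `1/s' = 1 - 1/s`). -/
def VargasBound (s : ℝ) (Ω : Set (ℝ × ℝ)) (c : ℝ) : Prop :=
  ∀ Ω' ⊆ Ω, MeasurableSet Ω' →
    eLpNorm (extOp (chi Ω')) (ENNReal.ofReal (2 * s)) volume ≤
      ENNReal.ofReal c * volume Ω ^ (1 - 1 / s)

/-- `𝓚(ε)`: the set of `K ≥ 0` for which `ε` is the smallest dyadic number such that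
`∥𝓔χ_{Ω'}∥_{L^{2s}} ≤ ε·|Ω(K)|^{1/s'}` holds for all measurable `Ω' ⊆ Ω(K)`. -/
def KsetOf (s : ℝ) (Ω : Set (ℝ × ℝ)) (ε : ℝ) : Set ℕ :=
  {K | VargasBound s (fiberPiece Ω K) ε ∧
    ∀ ε' : ℝ, IsDyadic ε' → ε' < ε → ¬ VargasBound s (fiberPiece Ω K) ε'}


/-! ### Basic facts on the extension operator of characteristic functions -/

lemma map_affine (u l : ℝ) (hl : 0 < l) :
    Measure.map (fun x : ℝ => u + l * x) volume = ENNReal.ofReal l⁻¹ • volume := by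
  have h1 : (fun x : ℝ => u + l * x) = (fun x => u + x) ∘ (fun x => l * x) := rfl
  rw [h1, ← Measure.map_map (by fun_prop) (by fun_prop), Real.map_volume_mul_left hl.ne',
    Measure.map_smul, map_add_left_eq_self, abs_of_pos (inv_pos.2 hl)]

/-- the affine map of frequency space -/
def psi (u₁ u₂ l₁ l₂ : ℝ) (x : ℝ × ℝ) : ℝ × ℝ := (u₁ + l₁ * x.1, u₂ + l₂ * x.2)

/-- the corresponding map of physical space -/
def phiM (u₁ u₂ l₁ l₂ : ℝ) (p : ℝ × ℝ × ℝ) : ℝ × ℝ × ℝ :=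
  (l₁ * l₂ * p.1, l₁ * (p.2.1 + p.1 * u₂), l₂ * (p.2.2 + p.1 * u₁))

lemma psi_meas (u₁ u₂ l₁ l₂ : ℝ) : Measurable (psi u₁ u₂ l₁ l₂) := by
  unfold psi; fun_prop

lemma phiM_meas (u₁ u₂ l₁ l₂ : ℝ) : Measurable (phiM u₁ u₂ l₁ l₂) := by
  unfold phiM; fun_prop

lemma map_psi (u₁ u₂ l₁ l₂ : ℝ) (h1 : 0 < l₁) (h2 : 0 < l₂) :
    Measure.map (psi u₁ u₂ l₁ l₂) volume = ENNReal.ofReal (l₁ * l₂)⁻¹ • volume := by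
  have : psi u₁ u₂ l₁ l₂ = Prod.map (fun x : ℝ => u₁ + l₁ * x) (fun x : ℝ => u₂ + l₂ * x) := rfl
  rw [this, Measure.volume_eq_prod, ← Measure.map_prod_map _ _ (by fun_prop) (by fun_prop),
    map_affine _ _ h1, map_affine _ _ h2, Measure.prod_smul_left, Measure.prod_smul_right,
    smul_smul, ← ENNReal.ofReal_mul (by positivity), mul_inv]

lemma map_phiM (u₁ u₂ l₁ l₂ : ℝ) (h1 : 0 < l₁) (h2 : 0 < l₂) :
    Measure.map (phiM u₁ u₂ l₁ l₂) volume = ENNReal.ofReal ((l₁ * l₂) ^ 2)⁻¹ • volume := by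
  have hsh : MeasurePreserving
      (fun p : ℝ × ℝ × ℝ => (p.1, (p.2.1 + p.1 * u₂, p.2.2 + p.1 * u₁))) volume volume := by
    have := MeasurePreserving.skew_product (μa := (volume : Measure ℝ)) (μb := (volume : Measure ℝ))
      (μc := (volume : Measure (ℝ × ℝ))) (μd := (volume : Measure (ℝ × ℝ)))
      (f := id) (MeasurePreserving.id _) (g := fun t x => (x.1 + t * u₂, x.2 + t * u₁))
      (by unfold Function.uncurry; fun_prop) (by
        refine Filter.Eventually.of_forall fun t => ?_
        have : (fun x : ℝ × ℝ => (x.1 + t * u₂, x.2 + t * u₁))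
          = fun x => x + (t * u₂, t * u₁) := rfl
        rw [this, map_add_right_eq_self])
    exact this
  have : phiM u₁ u₂ l₁ l₂ = (Prod.map (fun x : ℝ => 0 + (l₁ * l₂) * x)
      (Prod.map (fun x : ℝ => 0 + l₁ * x) (fun x : ℝ => 0 + l₂ * x))) ∘
      (fun p : ℝ × ℝ × ℝ => (p.1, (p.2.1 + p.1 * u₂, p.2.2 + p.1 * u₁))) := by
    ext p <;> simp [phiM]
  rw [this, ← Measure.map_map (by fun_prop) hsh.measurable, hsh.map_eq,
    Measure.volume_eq_prod, Measure.volume_eq_prod,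
    ← Measure.map_prod_map _ _ (by fun_prop) (by fun_prop),
    ← Measure.map_prod_map _ _ (by fun_prop) (by fun_prop),
    map_affine _ _ (mul_pos h1 h2), map_affine _ _ h1, map_affine _ _ h2]
  simp only [Measure.prod_smul_left, Measure.prod_smul_right, smul_smul]
  rw [← ENNReal.ofReal_mul (by positivity), ← ENNReal.ofReal_mul (by positivity)]
  congr 2
  field_simp

/-- the phase -/
def phase (p : ℝ × ℝ × ℝ) (ξ : ℝ × ℝ) : ℝ := p.1 * ξ.1 * ξ.2 + p.2.1 * ξ.1 + p.2.2 * ξ.2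

lemma phase_cont (p : ℝ × ℝ × ℝ) : Continuous (fun ξ => phase p ξ) := by
  unfold phase; fun_prop

lemma extOp_chi (A : Set (ℝ × ℝ)) (hA : MeasurableSet A) (p : ℝ × ℝ × ℝ) :
    extOp (chi A) p = ∫ ξ in A, Complex.exp (Complex.I * (phase p ξ : ℝ)) := by
  rw [← integral_indicator hA]
  unfold extOp chi
  congr 1
  ext ξ
  by_cases h : ξ ∈ A <;> simp [h, phase]

lemma norm_ker (p : ℝ × ℝ × ℝ) (ξ : ℝ × ℝ) :
    ‖Complex.exp (Complex.I * (phase p ξ : ℝ))‖ = 1 := by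
  rw [mul_comm, Complex.norm_exp_ofReal_mul_I]

lemma ker_intOn (A : Set (ℝ × ℝ)) (hA : volume A ≠ ⊤) (p : ℝ × ℝ × ℝ) :
    IntegrableOn (fun ξ => Complex.exp (Complex.I * (phase p ξ : ℝ))) A volume := by
  refine Measure.integrableOn_of_bounded (M := 1) hA ?_ ?_
  · have := phase_cont p
    exact (by fun_prop : Continuous fun ξ => Complex.exp (Complex.I * (phase p ξ : ℝ))).aestronglyMeasurable
  · exact Filter.Eventually.of_forall fun ξ => (norm_ker p ξ).le

lemma extOp_union (A B : Set (ℝ × ℝ)) (hA : MeasurableSet A) (hB : MeasurableSet B)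
    (hd : Disjoint A B) (fA : volume A ≠ ⊤) (fB : volume B ≠ ⊤) (p : ℝ × ℝ × ℝ) :
    extOp (chi (A ∪ B)) p = extOp (chi A) p + extOp (chi B) p := by
  rw [extOp_chi _ (hA.union hB), extOp_chi _ hA, extOp_chi _ hB,
    setIntegral_union hd hB (ker_intOn A fA p) (ker_intOn B fB p)]

lemma extOp_split (A B : Set (ℝ × ℝ)) (hA : MeasurableSet A) (hB : MeasurableSet B)
    (fA : volume A ≠ ⊤) (p : ℝ × ℝ × ℝ) :
    extOp (chi A) p = extOp (chi (A ∩ B)) p + extOp (chi (A \ B)) p := by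
  rw [← extOp_union _ _ (hA.inter hB) (hA.diff hB)
    (disjoint_sdiff_right.mono_left inter_subset_right)
    (ne_top_of_le_ne_top fA (measure_mono inter_subset_left))
    (ne_top_of_le_ne_top fA (measure_mono sdiff_subset)), inter_union_sdiff]

lemma extOp_biUnion {ι : Type*} (T : Finset ι) (A : ι → Set (ℝ × ℝ))
    (hA : ∀ i, MeasurableSet (A i)) (hd : ∀ i j, i ≠ j → Disjoint (A i) (A j))
    (fA : ∀ i, volume (A i) ≠ ⊤) (p : ℝ × ℝ × ℝ) :
    extOp (chi (⋃ i ∈ T, A i)) p = ∑ i ∈ T, extOp (chi (A i)) p := by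
  rw [extOp_chi _ (Finset.measurableSet_biUnion _ fun i _ => hA i),
    integral_biUnion_finset T (fun i _ => hA i) (fun i _ j _ h => hd i j h)
      (fun i _ => ker_intOn _ (fA i) p)]
  exact Finset.sum_congr rfl fun i _ => (extOp_chi _ (hA i) p).symm

lemma extOp_empty (p : ℝ × ℝ × ℝ) : extOp (chi ∅) p = 0 := by
  rw [extOp_chi _ MeasurableSet.empty]; simp

lemma extOp_enorm_le (A : Set (ℝ × ℝ)) (hA : MeasurableSet A) (p : ℝ × ℝ × ℝ) :
    ‖extOp (chi A) p‖ₑ ≤ volume A := by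
  rw [extOp_chi _ hA]
  refine (enorm_integral_le_lintegral_enorm _).trans ?_
  have : ∀ ξ, ‖Complex.exp (Complex.I * (phase p ξ : ℝ))‖ₑ = 1 := by
    intro ξ; rw [← ofReal_norm, norm_ker]; simp
  simp [this]

lemma extOp_cont (A : Set (ℝ × ℝ)) (hA : MeasurableSet A) (fA : volume A ≠ ⊤) :
    Continuous (extOp (chi A)) := by
  have : extOp (chi A) = fun p => ∫ ξ in A, Complex.exp (Complex.I * (phase p ξ : ℝ)) := by
    ext p; exact extOp_chi A hA p
  rw [this]
  refine continuous_of_dominated (bound := fun _ => 1) ?_ ?_ ?_ ?_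
  · intro p; exact (ker_intOn A fA p).aestronglyMeasurable
  · intro p; exact Filter.Eventually.of_forall fun ξ => (norm_ker p ξ).le
  · exact integrableOn_const fA
  · refine Filter.Eventually.of_forall fun ξ => ?_
    unfold phase; fun_prop

lemma extOp_meas (A : Set (ℝ × ℝ)) (hA : MeasurableSet A) (fA : volume A ≠ ⊤) :
    Measurable (extOp (chi A)) := (extOp_cont A hA fA).measurable

lemma psi_emb (u₁ u₂ l₁ l₂ : ℝ) (h1 : 0 < l₁) (h2 : 0 < l₂) :
    MeasurableEmbedding (psi u₁ u₂ l₁ l₂) := by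
  refine (psi_meas u₁ u₂ l₁ l₂).measurableEmbedding ?_
  rintro ⟨a, b⟩ ⟨c, d⟩ h
  simp only [psi, Prod.mk.injEq, add_right_inj, mul_eq_mul_left_iff, h1.ne', h2.ne', or_false] at h
  exact Prod.ext h.1 h.2

lemma vol_psi (u₁ u₂ l₁ l₂ : ℝ) (h1 : 0 < l₁) (h2 : 0 < l₂) (A : Set (ℝ × ℝ))
    (hA : MeasurableSet A) :
    volume (psi u₁ u₂ l₁ l₂ ⁻¹' A) = ENNReal.ofReal (l₁ * l₂)⁻¹ * volume A := by
  rw [← Measure.map_apply (psi_meas _ _ _ _) hA, map_psi _ _ _ _ h1 h2]; simp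

lemma extOp_scale (u₁ u₂ l₁ l₂ : ℝ) (h1 : 0 < l₁) (h2 : 0 < l₂) (A : Set (ℝ × ℝ))
    (hA : MeasurableSet A) (p : ℝ × ℝ × ℝ) :
    ‖extOp (chi A) p‖ₑ = ENNReal.ofReal (l₁ * l₂) *
      ‖extOp (chi (psi u₁ u₂ l₁ l₂ ⁻¹' A)) (phiM u₁ u₂ l₁ l₂ p)‖ₑ := by
  have e1 : (volume : Measure (ℝ × ℝ)) =
      ENNReal.ofReal (l₁ * l₂) • Measure.map (psi u₁ u₂ l₁ l₂) volume := by
    rw [map_psi _ _ _ _ h1 h2, smul_smul, ← ENNReal.ofReal_mul (by positivity),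
      mul_inv_cancel₀ (by positivity)]
    simp
  rw [extOp_chi _ hA, extOp_chi _ (psi_meas _ _ _ _ hA)]
  conv_lhs => rw [e1]
  rw [Measure.restrict_smul, integral_smul_measure,
    (psi_emb u₁ u₂ l₁ l₂ h1 h2).setIntegral_map]
  have e2 : ∀ η, Complex.exp (Complex.I * (phase p (psi u₁ u₂ l₁ l₂ η) : ℝ)) =
      Complex.exp (((p.1 * u₁ * u₂ + p.2.1 * u₁ + p.2.2 * u₂ : ℝ) : ℂ) * Complex.I) *
       Complex.exp (Complex.I * (phase (phiM u₁ u₂ l₁ l₂ p) η : ℝ)) := by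
    intro η
    rw [← Complex.exp_add]
    congr 1
    simp only [phase, psi, phiM]
    push_cast
    ring
  simp_rw [e2]
  rw [integral_const_mul, enorm_smul, enorm_mul]
  congr 1
  · rw [ENNReal.toReal_ofReal (by positivity), Real.enorm_eq_ofReal (by positivity)]
  · rw [← ofReal_norm (Complex.exp _), Complex.norm_exp_ofReal_mul_I]; simp

lemma lint_phiM (u₁ u₂ l₁ l₂ : ℝ) (h1 : 0 < l₁) (h2 : 0 < l₂) (g : ℝ × ℝ × ℝ → ℝ≥0∞)
    (hg : Measurable g) :
    ∫⁻ p, g (phiM u₁ u₂ l₁ l₂ p) = ENNReal.ofReal ((l₁ * l₂) ^ 2)⁻¹ * ∫⁻ p, g p := by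
  rw [← lintegral_map hg (phiM_meas _ _ _ _), map_phiM _ _ _ _ h1 h2, lintegral_smul_measure]
  rfl

/-! ### Rescaled bilinear estimate -/

lemma eLpNorm_scale (u₁ u₂ l₁ l₂ q : ℝ) (h1 : 0 < l₁) (h2 : 0 < l₂) (hq : 0 < q)
    (F G : ℝ × ℝ × ℝ → ℂ) (hG : Measurable G) (c : ℝ) (hc : 0 ≤ c)
    (h : ∀ p, ‖F p‖ₑ = ENNReal.ofReal c * ‖G (phiM u₁ u₂ l₁ l₂ p)‖ₑ) :
    eLpNorm F (ENNReal.ofReal q) volume =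
      ENNReal.ofReal (c * (l₁ * l₂) ^ (-2 / q)) * eLpNorm G (ENNReal.ofReal q) volume := by
  have hq0 : ENNReal.ofReal q ≠ 0 := by simpa using hq
  rw [eLpNorm_eq_lintegral_rpow_enorm_toReal hq0 ENNReal.ofReal_ne_top,
    eLpNorm_eq_lintegral_rpow_enorm_toReal hq0 ENNReal.ofReal_ne_top,
    ENNReal.toReal_ofReal hq.le]
  simp_rw [h, ENNReal.mul_rpow_of_nonneg _ _ hq.le]
  rw [lintegral_const_mul' _ _ (by finiteness),
    lint_phiM u₁ u₂ l₁ l₂ h1 h2 (fun p => ‖G p‖ₑ ^ q) (by fun_prop),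
    ENNReal.mul_rpow_of_nonneg _ _ (by positivity), ENNReal.mul_rpow_of_nonneg _ _ (by positivity),
    ← mul_assoc, ← ENNReal.rpow_mul, mul_one_div_cancel hq.ne', ENNReal.rpow_one,
    ENNReal.ofReal_rpow_of_nonneg (by positivity) (by positivity), ← ENNReal.ofReal_mul hc]
  congr 3
  have hl : 0 < l₁ * l₂ := mul_pos h1 h2
  rw [Real.inv_rpow (by positivity), ← Real.rpow_natCast, ← Real.rpow_mul hl.le,
    ← Real.rpow_neg hl.le]
  congr 1
  push_cast; ring

lemma eLpNorm_chi_le (r r₁ : ℝ) (hr : r < r₁) (hr₁ : 0 < r₁) (A : Set (ℝ × ℝ))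
    (hA : MeasurableSet A) (hv : volume A ≤ 1) :
    eLpNorm (chi A) (ENNReal.ofReal r) volume ≤ volume A ^ (1 / r₁) := by
  rcases le_or_gt r 0 with h | h
  · rw [ENNReal.ofReal_of_nonpos h]; simp
  · unfold chi
    rw [eLpNorm_indicator_const hA (by simpa using h) ENNReal.ofReal_ne_top,
      ENNReal.toReal_ofReal h.le]
    simp only [enorm_one, one_mul]
    exact ENNReal.rpow_le_rpow_of_exponent_ge hv (one_div_le_one_div_of_le h hr.le)

lemma vol_rect (a b w h : ℝ) (hw : 0 ≤ w) :
    volume (Icc a (a + w) ×ˢ Icc b (b + h)) = ENNReal.ofReal (w * h) := by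
  rw [Measure.volume_eq_prod, Measure.prod_prod, Real.volume_Icc, Real.volume_Icc,
    ← ENNReal.ofReal_mul (by linarith)]
  congr 1; ring

lemma ne_top_of_rect {a b w h : ℝ} (hw : 0 ≤ w) {A : Set (ℝ × ℝ)}
    (hA : A ⊆ Icc a (a + w) ×ˢ Icc b (b + h)) : volume A ≠ ⊤ :=
  ne_top_of_le_ne_top (by rw [vol_rect _ _ _ _ hw]; exact ENNReal.ofReal_ne_top) (measure_mono hA)

lemma bh_rect (s r r₁ C : ℝ) (hs₁ : 3 / 2 < s) (hr : r < r₁) (hr₁ : 0 < r₁)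
    (hr₁' : r₁ < s / (s - 1)) (hBH : BH s r C)
    (u₁ u₂ v₁ v₂ w₁ w₂ : ℝ) (hw₁ : 0 < w₁) (hw₂ : 0 < w₂)
    (hd₁ : 3 * w₁ ≤ |u₁ - v₁|) (hd₂ : 3 * w₂ ≤ |u₂ - v₂|)
    (A B : Set (ℝ × ℝ)) (hA : MeasurableSet A) (hB : MeasurableSet B)
    (hAs : A ⊆ Icc u₁ (u₁ + w₁) ×ˢ Icc u₂ (u₂ + w₂))
    (hBs : B ⊆ Icc v₁ (v₁ + w₁) ×ˢ Icc v₂ (v₂ + w₂)) :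
    eLpNorm (fun p => extOp (chi A) p * extOp (chi B) p) (ENNReal.ofReal s) volume ≤
      ENNReal.ofReal C * ENNReal.ofReal ((w₁ * w₂) ^ (2 * (1 - 1 / s) - 2 * (1 / r₁))) *
        volume A ^ (1 / r₁) * volume B ^ (1 / r₁) := by
  have hs0 : 0 < s := by linarith
  set d₁ := |u₁ - v₁| / 3 with hd₁def
  set d₂ := |u₂ - v₂| / 3 with hd₂def
  have hwd₁ : w₁ ≤ d₁ := by rw [hd₁def]; linarith
  have hwd₂ : w₂ ≤ d₂ := by rw [hd₂def]; linarith
  have d₁p : 0 < d₁ := by linarith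
  have d₂p : 0 < d₂ := by linarith
  have hDp : 0 < d₁ * d₂ := mul_pos d₁p d₂p
  set A' := psi u₁ u₂ d₁ d₂ ⁻¹' A with hA'
  set B' := psi u₁ u₂ d₁ d₂ ⁻¹' B with hB'
  have mA' : MeasurableSet A' := psi_meas _ _ _ _ hA
  have mB' : MeasurableSet B' := psi_meas _ _ _ _ hB
  have sA' : A' ⊆ unitSq 0 0 := by
    rintro ⟨x, y⟩ hx
    have := hAs hx
    simp only [psi, mem_prod, mem_Icc] at this
    obtain ⟨⟨a, b⟩, c, d⟩ := this
    simp only [unitSq, mem_prod, mem_Icc, zero_add]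
    refine ⟨⟨?_, ?_⟩, ?_, ?_⟩ <;> by_contra! hh <;> nlinarith
  have sB' : B' ⊆ unitSq ((v₁ - u₁) / d₁) ((v₂ - u₂) / d₂) := by
    rintro ⟨x, y⟩ hx
    have := hBs hx
    simp only [psi, mem_prod, mem_Icc] at this
    obtain ⟨⟨a, b⟩, c, d⟩ := this
    simp only [unitSq, mem_prod, mem_Icc]
    refine ⟨⟨?_, ?_⟩, ?_, ?_⟩
    · rw [div_le_iff₀ d₁p]; linarith
    · rw [div_add_one d₁p.ne', le_div_iff₀ d₁p]; linarith
    · rw [div_le_iff₀ d₂p]; linarith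
    · rw [div_add_one d₂p.ne', le_div_iff₀ d₂p]; linarith
  have vsq : ∀ a b, volume (unitSq a b) = 1 := by
    intro a b; unfold unitSq; rw [vol_rect _ _ _ _ (by norm_num)]; simp
  have vA' : volume A' ≤ 1 := (measure_mono sA').trans (vsq _ _).le
  have vB' : volume B' ≤ 1 := (measure_mono sB').trans (vsq _ _).le
  have habs : ∀ u v d : ℝ, d = |u - v| / 3 → 0 < d → |0 - (v - u) / d| = 3 := by
    intro u v d hd hdp
    have : 0 - (v - u) / d = (u - v) / d := by ring
    rw [this, abs_div, abs_of_pos hdp, div_eq_iff hdp.ne', hd]; ring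
  have key := hBH 0 0 ((v₁ - u₁) / d₁) ((v₂ - u₂) / d₂)
    (by rw [habs _ _ _ hd₁def d₁p]; norm_num) (by rw [habs _ _ _ hd₁def d₁p]; norm_num)
    (by rw [habs _ _ _ hd₂def d₂p]; norm_num) (by rw [habs _ _ _ hd₂def d₂p]; norm_num)
    (chi A') (chi B') (by unfold chi; exact support_indicator_subset.trans sA')
    (by unfold chi; exact support_indicator_subset.trans sB')
  have tA : volume A' ≠ ⊤ := ne_top_of_le_ne_top ENNReal.one_ne_top vA'
  have tB : volume B' ≠ ⊤ := ne_top_of_le_ne_top ENNReal.one_ne_top vB'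
  rw [eLpNorm_scale u₁ u₂ d₁ d₂ s d₁p d₂p hs0 _
    (fun p => extOp (chi A') p * extOp (chi B') p)
    ((extOp_meas A' mA' tA).mul (extOp_meas B' mB' tB)) ((d₁ * d₂) ^ 2) (by positivity) (by
      intro p
      rw [enorm_mul, enorm_mul, extOp_scale u₁ u₂ d₁ d₂ d₁p d₂p A hA,
        extOp_scale u₁ u₂ d₁ d₂ d₁p d₂p B hB, pow_two, ENNReal.ofReal_mul hDp.le]
      ring)]
  have key2 : eLpNorm (fun p => extOp (chi A') p * extOp (chi B') p) (ENNReal.ofReal s) volume ≤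
      ENNReal.ofReal C * volume A' ^ (1 / r₁) * volume B' ^ (1 / r₁) :=
    key.trans (by
      gcongr
      · exact eLpNorm_chi_le r r₁ hr hr₁ A' mA' vA'
      · exact eLpNorm_chi_le r r₁ hr hr₁ B' mB' vB')
  rw [hA', hB', vol_psi _ _ _ _ d₁p d₂p A hA, vol_psi _ _ _ _ d₁p d₂p B hB,
    ENNReal.mul_rpow_of_nonneg _ _ (by positivity), ENNReal.mul_rpow_of_nonneg _ _ (by positivity),
    ENNReal.ofReal_rpow_of_nonneg (by positivity) (by positivity)] at key2
  have hexp : 2 * (1 - 1 / s) - 2 * (1 / r₁) ≤ 0 := by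
    have : 1 - 1 / s = 1 / (s / (s - 1)) := by field_simp
    rw [this]
    have := one_div_le_one_div_of_le hr₁ hr₁'.le
    linarith
  have hcoef : (d₁ * d₂) ^ 2 * (d₁ * d₂) ^ (-2 / s) *
      (((d₁ * d₂)⁻¹ ^ (1 / r₁)) * ((d₁ * d₂)⁻¹ ^ (1 / r₁))) ≤
      (w₁ * w₂) ^ (2 * (1 - 1 / s) - 2 * (1 / r₁)) := by
    have e : (d₁ * d₂) ^ 2 * (d₁ * d₂) ^ (-2 / s) *
      (((d₁ * d₂)⁻¹ ^ (1 / r₁)) * ((d₁ * d₂)⁻¹ ^ (1 / r₁))) =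
        (d₁ * d₂) ^ (2 * (1 - 1 / s) - 2 * (1 / r₁)) := by
      rw [Real.inv_rpow hDp.le, ← Real.rpow_neg hDp.le, ← Real.rpow_natCast, ← Real.rpow_add hDp,
        ← Real.rpow_add hDp, ← Real.rpow_add hDp]
      congr 1; push_cast; ring
    rw [e]
    exact Real.rpow_le_rpow_of_nonpos (mul_pos hw₁ hw₂)
      (mul_le_mul hwd₁ hwd₂ hw₂.le d₁p.le) hexp
  calc _ ≤ ENNReal.ofReal ((d₁ * d₂) ^ 2 * (d₁ * d₂) ^ (-2 / s)) * _ := mul_le_mul_right key2 _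
    _ = ENNReal.ofReal C * ENNReal.ofReal ((d₁ * d₂) ^ 2 * (d₁ * d₂) ^ (-2 / s) *
      (((d₁ * d₂)⁻¹ ^ (1 / r₁)) * ((d₁ * d₂)⁻¹ ^ (1 / r₁)))) *
        volume A ^ (1 / r₁) * volume B ^ (1 / r₁) := by
        rw [ENNReal.ofReal_mul (p := (d₁ * d₂) ^ 2 * (d₁ * d₂) ^ (-2 / s)) (by positivity),
          ENNReal.ofReal_mul (p := (d₁ * d₂)⁻¹ ^ (1 / r₁)) (by positivity)]
        ring
    _ ≤ _ := by gcongr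

/-! ### The linear estimate, by a broad-narrow argument -/

/-- two indices are far apart -/
def farI {n : ℕ} (i i' : Fin n) : Prop := 3 ≤ |(i : ℤ) - (i' : ℤ)|

open Classical in
lemma near_card {n : ℕ} (i₀ : Fin n) :
    (Finset.univ.filter fun i : Fin n => ¬ farI i i₀).card ≤ 5 := by
  have : (Finset.univ.filter fun i : Fin n => ¬ farI i i₀).card ≤
      (Finset.Icc ((i₀ : ℤ) - 2) ((i₀ : ℤ) + 2)).card := by
    refine Finset.card_le_card_of_injOn (fun i => (i : ℤ)) ?_ ?_
    · intro i hi
      simp only [farI, Finset.coe_filter, Finset.mem_univ, true_and, mem_ofPred_eq, not_le] at hi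
      rw [abs_lt] at hi
      simp only [Finset.coe_Icc, mem_Icc]
      omega
    · intro i _ j _ h
      have : (i : ℤ) = (j : ℤ) := h
      exact Fin.ext (by exact_mod_cast this)
  refine this.trans ?_
  rw [Int.card_Icc]
  omega

lemma le_root {q : ℝ} (hq : 0 < q) {x G : ℝ≥0∞} (h : x ^ q ≤ G) : x ≤ G ^ (1 / q) := by
  calc x = (x ^ q) ^ (1 / q) := by
        rw [← ENNReal.rpow_mul, mul_one_div_cancel hq.ne', ENNReal.rpow_one]
    _ ≤ _ := by gcongr

open Classical in
lemma pw (s : ℝ) (hs : 0 < s) (n : ℕ) (a : Fin n → Fin n → ℂ) :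
    ‖∑ i, ∑ j, a i j‖ₑ ^ (2 * s) ≤ 36 ^ (2 * s) *
      ((∑ i, ‖∑ j, a i j‖ₑ ^ (2 * s)) + (∑ j, ‖∑ i, a i j‖ₑ ^ (2 * s)) +
        (∑ i, ∑ j, ‖a i j‖ₑ ^ (2 * s)) +
        ((n : ℝ≥0∞) * n) ^ (2 * s) * ∑ i, ∑ j, ∑ i', ∑ j',
          if farI i i' ∧ farI j j' then ‖a i j * a i' j'‖ₑ ^ s else 0) := by
  have hq : 0 < 2 * s := by linarith
  rcases Nat.eq_zero_or_pos n with rfl | hn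
  · simp [hs]
  set F := ∑ i, ∑ j, ∑ i', ∑ j',
          if farI i i' ∧ farI j j' then ‖a i j * a i' j'‖ₑ ^ s else 0 with hF
  set SC := ∑ i, ‖∑ j, a i j‖ₑ ^ (2 * s) with hSC
  set SR := ∑ j, ‖∑ i, a i j‖ₑ ^ (2 * s) with hSR
  set SZ := ∑ i, ∑ j, ‖a i j‖ₑ ^ (2 * s) with hSZ
  set G := SC + SR + SZ + ((n : ℝ≥0∞) * n) ^ (2 * s) * F with hG
  set g := G ^ (1 / (2 * s)) with hg
  have hC : ∀ i, ‖∑ j, a i j‖ₑ ≤ g := by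
    intro i
    apply le_root hq
    have : ‖∑ j, a i j‖ₑ ^ (2 * s) ≤ SC :=
      Finset.single_le_sum (f := fun i => ‖∑ j, a i j‖ₑ ^ (2 * s)) (fun _ _ => zero_le)
        (Finset.mem_univ i)
    refine this.trans ?_
    rw [hG, add_assoc, add_assoc]; exact le_self_add
  have hR : ∀ j, ‖∑ i, a i j‖ₑ ≤ g := by
    intro j
    apply le_root hq
    have : ‖∑ i, a i j‖ₑ ^ (2 * s) ≤ SR :=
      Finset.single_le_sum (f := fun j => ‖∑ i, a i j‖ₑ ^ (2 * s)) (fun _ _ => zero_le)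
        (Finset.mem_univ j)
    refine this.trans ?_
    rw [hG, add_assoc, add_comm SC, add_assoc]; exact le_self_add
  have hZ : ∀ i j, ‖a i j‖ₑ ≤ g := by
    intro i j
    apply le_root hq
    have h1 : ‖a i j‖ₑ ^ (2 * s) ≤ ∑ j, ‖a i j‖ₑ ^ (2 * s) :=
      Finset.single_le_sum (f := fun j => ‖a i j‖ₑ ^ (2 * s)) (fun _ _ => zero_le)
        (Finset.mem_univ j)
    have h2 : ∑ j, ‖a i j‖ₑ ^ (2 * s) ≤ SZ :=
      Finset.single_le_sum (f := fun i => ∑ j, ‖a i j‖ₑ ^ (2 * s)) (fun _ _ => zero_le)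
        (Finset.mem_univ i)
    refine (h1.trans h2).trans ?_
    rw [hG, add_comm (SC + SR), add_assoc]; exact le_self_add
  -- the maximal cell
  obtain ⟨⟨i₀, j₀⟩, -, hmax⟩ := Finset.exists_max_image (Finset.univ : Finset (Fin n × Fin n))
    (fun x => ‖a x.1 x.2‖ₑ) ⟨(⟨0, hn⟩, ⟨0, hn⟩), Finset.mem_univ _⟩
  have hfar : ∀ i j, farI i i₀ → farI j j₀ → (n : ℝ≥0∞) * n * ‖a i j‖ₑ ≤ g := by
    intro i j hi hj
    apply le_root hq
    rw [ENNReal.mul_rpow_of_nonneg _ _ hq.le]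
    refine le_trans ?_ (le_add_self : _ ≤ G)
    gcongr
    have h0 : ‖a i j‖ₑ ^ (2 * s) ≤ ‖a i j * a i₀ j₀‖ₑ ^ s := by
      rw [ENNReal.rpow_mul, enorm_mul]
      gcongr
      rw [ENNReal.rpow_two, pow_two]
      gcongr
      exact hmax (i, j) (Finset.mem_univ _)
    have h1 : ‖a i j * a i₀ j₀‖ₑ ^ s ≤
        ∑ j', if farI i i₀ ∧ farI j j' then ‖a i j * a i₀ j'‖ₑ ^ s else 0 := by
      refine le_trans (le_of_eq ?_) (Finset.single_le_sum
        (f := fun j' => if farI i i₀ ∧ farI j j' then ‖a i j * a i₀ j'‖ₑ ^ s else 0)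
        (fun _ _ => zero_le) (Finset.mem_univ j₀))
      simp [hi, hj]
    have h2 := Finset.single_le_sum
      (f := fun i' => ∑ j', if farI i i' ∧ farI j j' then ‖a i j * a i' j'‖ₑ ^ s else 0)
      (fun _ _ => zero_le) (Finset.mem_univ i₀)
    have h3 := Finset.single_le_sum
      (f := fun j => ∑ i', ∑ j', if farI i i' ∧ farI j j' then ‖a i j * a i' j'‖ₑ ^ s else 0)
      (fun _ _ => zero_le) (Finset.mem_univ j)
    have h4 := Finset.single_le_sum
      (f := fun i => ∑ j, ∑ i', ∑ j', if farI i i' ∧ farI j j' then ‖a i j * a i' j'‖ₑ ^ s else 0)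
      (fun _ _ => zero_le) (Finset.mem_univ i)
    exact h0.trans (h1.trans (h2.trans (h3.trans h4)))
  set N := Finset.univ.filter fun i : Fin n => ¬ farI i i₀ with hN
  set N' := Finset.univ.filter fun i : Fin n => farI i i₀ with hN'
  set M := Finset.univ.filter fun i : Fin n => ¬ farI i j₀ with hM
  set M' := Finset.univ.filter fun i : Fin n => farI i j₀ with hM'
  have sp1 : ∀ f : Fin n → ℂ, ∑ i, f i = ∑ i ∈ N', f i + ∑ i ∈ N, f i := fun f =>
    (Finset.sum_filter_add_sum_filter_not _ _ _).symm
  have sp2 : ∀ f : Fin n → ℂ, ∑ i, f i = ∑ i ∈ M', f i + ∑ i ∈ M, f i := fun f =>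
    (Finset.sum_filter_add_sum_filter_not _ _ _).symm
  have split : ∑ i, ∑ j, a i j = ∑ i ∈ N, ∑ j, a i j + ∑ j ∈ M, ∑ i, a i j
      - ∑ i ∈ N, ∑ j ∈ M, a i j + ∑ i ∈ N', ∑ j ∈ M', a i j := by
    rw [sp1 (fun i => ∑ j, a i j)]
    have e1 : ∑ i ∈ N', ∑ j, a i j = ∑ i ∈ N', ∑ j ∈ M', a i j + ∑ i ∈ N', ∑ j ∈ M, a i j := by
      rw [← Finset.sum_add_distrib]; exact Finset.sum_congr rfl fun i _ => sp2 _
    have e2 : ∑ j ∈ M, ∑ i, a i j = ∑ i ∈ N', ∑ j ∈ M, a i j + ∑ i ∈ N, ∑ j ∈ M, a i j := by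
      rw [Finset.sum_comm (s := N'), Finset.sum_comm (s := N), ← Finset.sum_add_distrib]
      exact Finset.sum_congr rfl fun j _ => sp1 _
    rw [e1, e2]; ring
  have cN : (N.card : ℝ≥0∞) ≤ 5 := by exact_mod_cast near_card i₀
  have cM : (M.card : ℝ≥0∞) ≤ 5 := by exact_mod_cast near_card j₀
  have sumle : ∀ (T : Finset (Fin n)) (f : Fin n → ℂ) (B : ℝ≥0∞), (∀ i ∈ T, ‖f i‖ₑ ≤ B) →
      ‖∑ i ∈ T, f i‖ₑ ≤ T.card * B := by
    intro T f B h
    refine (enorm_sum_le _ _).trans ((Finset.sum_le_sum h).trans ?_)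
    simp
  have b1 : ‖∑ i ∈ N, ∑ j, a i j‖ₑ ≤ 5 * g :=
    (sumle _ _ _ fun i _ => hC i).trans (by gcongr)
  have b2 : ‖∑ j ∈ M, ∑ i, a i j‖ₑ ≤ 5 * g :=
    (sumle _ _ _ fun i _ => hR i).trans (by gcongr)
  have b3 : ‖∑ i ∈ N, ∑ j ∈ M, a i j‖ₑ ≤ 5 * (5 * g) :=
    (sumle _ _ (5 * g) fun i _ => (sumle _ _ _ fun j _ => hZ i j).trans (by gcongr)).trans
      (by gcongr)
  have b4 : ‖∑ i ∈ N', ∑ j ∈ M', a i j‖ₑ ≤ g := by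
    have hn0 : (n : ℝ≥0∞) ≠ 0 := by exact_mod_cast hn.ne'
    have hnt : (n : ℝ≥0∞) ≠ ⊤ := ENNReal.natCast_ne_top n
    have cT : ∀ T : Finset (Fin n), (T.card : ℝ≥0∞) ≤ n := fun T => by
      exact_mod_cast (Finset.card_le_univ T).trans (by simp)
    have hb : ∀ i ∈ N', ∀ j ∈ M', ‖a i j‖ₑ ≤ g / ((n : ℝ≥0∞) * n) := by
      intro i hi j hj
      rw [ENNReal.le_div_iff_mul_le (Or.inl (mul_ne_zero hn0 hn0))
        (Or.inl (ENNReal.mul_ne_top hnt hnt)), mul_comm]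
      exact hfar i j (by simpa [hN'] using hi) (by simpa [hM'] using hj)
    refine (sumle _ _ (n * (g / ((n : ℝ≥0∞) * n))) fun i hi =>
      (sumle _ _ _ fun j hj => hb i hi j hj).trans (by gcongr; exact_mod_cast cT _)).trans ?_
    calc _ ≤ (n : ℝ≥0∞) * (n * (g / ((n : ℝ≥0∞) * n))) := by gcongr; exact_mod_cast cT _
      _ = g := by
        rw [← mul_assoc, ENNReal.mul_div_cancel (mul_ne_zero hn0 hn0) (ENNReal.mul_ne_top hnt hnt)]
  have tot : ‖∑ i, ∑ j, a i j‖ₑ ≤ 36 * g := by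
    rw [split]
    calc _ ≤ ‖∑ i ∈ N, ∑ j, a i j‖ₑ + ‖∑ j ∈ M, ∑ i, a i j‖ₑ + ‖∑ i ∈ N, ∑ j ∈ M, a i j‖ₑ +
          ‖∑ i ∈ N', ∑ j ∈ M', a i j‖ₑ := by
          refine (enorm_add_le _ _).trans ?_
          gcongr
          refine (enorm_sub_le).trans ?_
          gcongr
          exact enorm_add_le _ _
      _ ≤ 5 * g + 5 * g + 5 * (5 * g) + g := by gcongr
      _ = 36 * g := by ring
  calc _ ≤ (36 * g) ^ (2 * s) := by gcongr
    _ = _ := by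
      rw [ENNReal.mul_rpow_of_nonneg _ _ hq.le, hg, ← ENNReal.rpow_mul, one_div_mul_cancel hq.ne',
        ENNReal.rpow_one]

lemma lin_scale (u₁ u₂ l₁ l₂ q : ℝ) (h1 : 0 < l₁) (h2 : 0 < l₂) (hq : 0 < q)
    (A : Set (ℝ × ℝ)) (hA : MeasurableSet A)
    (hAs : A ⊆ Ico u₁ (u₁ + l₁) ×ˢ Ico u₂ (u₂ + l₂))
    (D D' : Set (ℝ × ℝ × ℝ)) (mD : MeasurableSet D) (mD' : MeasurableSet D')
    (hD : ∀ p ∈ D, phiM u₁ u₂ l₁ l₂ p ∈ D') (V : ℝ≥0∞)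
    (hV : ∀ A' : Set (ℝ × ℝ), MeasurableSet A' → A' ⊆ Ico 0 1 ×ˢ Ico 0 1 →
      ∫⁻ p in D', ‖extOp (chi A') p‖ₑ ^ q ≤ V) :
    ∫⁻ p in D, ‖extOp (chi A) p‖ₑ ^ q ≤ ENNReal.ofReal ((l₁ * l₂) ^ (q - 2)) * V := by
  have hl : 0 < l₁ * l₂ := mul_pos h1 h2
  set A' := psi u₁ u₂ l₁ l₂ ⁻¹' A with hA'
  have mA' : MeasurableSet A' := psi_meas _ _ _ _ hA
  have sA' : A' ⊆ Ico 0 1 ×ˢ Ico 0 1 := by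
    rintro ⟨x, y⟩ hx
    have := hAs hx
    simp only [psi, mem_prod, mem_Ico] at this
    obtain ⟨⟨a, b⟩, c, d⟩ := this
    simp only [mem_prod, mem_Ico]
    refine ⟨⟨?_, ?_⟩, ?_, ?_⟩ <;> by_contra! hh <;> nlinarith
  have fA' : volume A' ≠ ⊤ := by
    refine ne_top_of_rect (a := 0) (b := 0) (w := 1) (h := 1) (by norm_num) (sA'.trans ?_)
    simp only [zero_add]
    exact prod_mono Ico_subset_Icc_self Ico_subset_Icc_self
  have mE : Measurable (extOp (chi A')) := extOp_meas A' mA' fA'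
  rw [← lintegral_indicator mD]
  calc ∫⁻ p, D.indicator (fun p => ‖extOp (chi A) p‖ₑ ^ q) p
      ≤ ∫⁻ p, ENNReal.ofReal (l₁ * l₂) ^ q *
          D'.indicator (fun p => ‖extOp (chi A') p‖ₑ ^ q) (phiM u₁ u₂ l₁ l₂ p) := by
        refine lintegral_mono fun p => ?_
        by_cases hp : p ∈ D
        · rw [indicator_of_mem hp, indicator_of_mem (hD p hp),
            extOp_scale u₁ u₂ l₁ l₂ h1 h2 A hA, ENNReal.mul_rpow_of_nonneg _ _ hq.le]
        · rw [indicator_of_notMem hp]; exact zero_le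
    _ = ENNReal.ofReal (l₁ * l₂) ^ q * (ENNReal.ofReal ((l₁ * l₂) ^ 2)⁻¹ *
          ∫⁻ p in D', ‖extOp (chi A') p‖ₑ ^ q) := by
        rw [lintegral_const_mul' _ _ (by finiteness),
          lint_phiM u₁ u₂ l₁ l₂ h1 h2 _ ((mE.enorm.pow_const q).indicator mD'),
          lintegral_indicator mD']
    _ ≤ ENNReal.ofReal (l₁ * l₂) ^ q * (ENNReal.ofReal ((l₁ * l₂) ^ 2)⁻¹ * V) := by
        gcongr; exact hV A' mA' sA'
    _ = _ := by
        rw [← mul_assoc, ENNReal.ofReal_rpow_of_nonneg hl.le hq.le,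
          ← ENNReal.ofReal_mul (by positivity)]
        congr 2
        rw [Real.rpow_sub hl, Real.rpow_two, div_eq_mul_inv]

/-- the truncation region -/
def DR (R : ℝ) : Set (ℝ × ℝ × ℝ) :=
  {p | |p.2.1| + 2 * |p.1| ≤ R ∧ |p.2.2| + 2 * |p.1| ≤ R}

lemma DR_closed (R : ℝ) : IsClosed (DR R) := by
  unfold DR
  rw [ofPred_and]
  exact (isClosed_le (by fun_prop) (by fun_prop)).inter (isClosed_le (by fun_prop) (by fun_prop))

lemma DR_meas (R : ℝ) : MeasurableSet (DR R) := (DR_closed R).measurableSet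

lemma DR_finite (R : ℝ) : volume (DR R) ≠ ⊤ := by
  have hsub : DR R ⊆ Icc (-R) R ×ˢ (Icc (-R) R ×ˢ Icc (-R) R) := by
    rintro ⟨t, x, y⟩ ⟨h1, h2⟩
    simp only at h1 h2
    have := abs_nonneg t
    have := abs_nonneg x
    have := abs_nonneg y
    simp only [mem_prod, mem_Icc, ← abs_le]
    refine ⟨?_, ?_, ?_⟩ <;> linarith
  have hc : IsCompact (Icc (-R) R ×ˢ (Icc (-R) R ×ˢ Icc (-R) R)) :=
    isCompact_Icc.prod (isCompact_Icc.prod isCompact_Icc)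
  exact ne_top_of_le_ne_top hc.measure_lt_top.ne (measure_mono hsub)

lemma DR_phi (R u₁ u₂ l₁ l₂ : ℝ) (hu₁ : |u₁| ≤ 1) (hu₂ : |u₂| ≤ 1) (h1 : 0 < l₁) (h2 : 0 < l₂)
    (h1' : l₁ ≤ 1) (h2' : l₂ ≤ 1) (hl : l₁ * l₂ ≤ 1 / 2) :
    ∀ p ∈ DR R, phiM u₁ u₂ l₁ l₂ p ∈ DR R := by
  rintro ⟨t, x, y⟩ ⟨g1, g2⟩
  simp only at g1 g2
  have key : ∀ (x l u : ℝ), 0 < l → l ≤ 1 → |u| ≤ 1 →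
      |l * (x + t * u)| + 2 * |l₁ * l₂ * t| ≤ |x| + 2 * |t| := by
    intro x l u hl0 hl1 hu
    rw [abs_mul, abs_mul (l₁ * l₂), abs_of_pos hl0, abs_of_pos (mul_pos h1 h2)]
    have a1 : |x + t * u| ≤ |x| + |t| * |u| := (abs_add_le _ _).trans (by rw [abs_mul])
    have a2 : |t| * |u| ≤ |t| := mul_le_of_le_one_right (abs_nonneg _) hu
    have a3 : l * |x + t * u| ≤ |x + t * u| := mul_le_of_le_one_left (abs_nonneg _) hl1
    have a4 : l₁ * l₂ * |t| ≤ 1 / 2 * |t| := by gcongr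
    linarith
  exact ⟨(key x l₁ u₂ h1 h1' hu₂).trans g1, (key y l₂ u₁ h2 h2' hu₁).trans g2⟩

/-- grid interval -/
def gr (n : ℕ) (i : Fin n) : Set ℝ := Ico ((i : ℝ) / n) ((i : ℝ) / n + 1 / n)

lemma gr_cover (n : ℕ) (hn : 0 < n) (x : ℝ) (hx : x ∈ Ico (0 : ℝ) 1) : ∃ i, x ∈ gr n i := by
  have hn' : (0 : ℝ) < n := by exact_mod_cast hn
  have h0 : 0 ≤ x * n := mul_nonneg hx.1 hn'.le
  refine ⟨⟨⌊x * n⌋₊, ?_⟩, ?_, ?_⟩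
  · rw [Nat.floor_lt h0]; nlinarith [hx.2]
  · rw [div_le_iff₀ hn']; exact Nat.floor_le h0
  · rw [← add_div, lt_div_iff₀ hn']; exact Nat.lt_floor_add_one _

lemma gr_disj (n : ℕ) (i j : Fin n) (h : i ≠ j) : Disjoint (gr n i) (gr n j) := by
  have hn' : (0 : ℝ) < n := by exact_mod_cast i.pos
  rw [Set.disjoint_left]
  rintro x ⟨h1, h2⟩ ⟨h3, h4⟩
  rw [div_le_iff₀ hn'] at h1 h3
  rw [← add_div, lt_div_iff₀ hn'] at h2 h4
  apply h
  have a : (i : ℝ) < j + 1 := by linarith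
  have b : (j : ℝ) < i + 1 := by linarith
  have a' : (i : ℕ) < j + 1 := by exact_mod_cast a
  have b' : (j : ℕ) < i + 1 := by exact_mod_cast b
  exact Fin.ext (by omega)

lemma gr_meas (n : ℕ) (i : Fin n) : MeasurableSet (gr n i) := measurableSet_Ico

lemma far_gr (n : ℕ) (i i' : Fin n) (h : farI i i') : 3 * (1 / (n : ℝ)) ≤ |(i : ℝ) / n - i' / n| := by
  have hn' : (0 : ℝ) < n := by exact_mod_cast i.pos
  rw [← sub_div, abs_div, abs_of_pos hn', ← mul_div_assoc]
  gcongr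
  have : (3 : ℝ) ≤ |(i : ℝ) - (i' : ℝ)| := by
    unfold farI at h; exact_mod_cast h
  simpa using this

lemma lint_expand {n : ℕ} {μ : Measure (ℝ × ℝ × ℝ)} (a b : ℝ≥0∞) (ha : a ≠ ⊤) (hb : b ≠ ⊤)
    (g₁ g₂ : Fin n → ℝ × ℝ × ℝ → ℝ≥0∞) (g₃ : Fin n → Fin n → ℝ × ℝ × ℝ → ℝ≥0∞)
    (g₄ : Fin n → Fin n → Fin n → Fin n → ℝ × ℝ × ℝ → ℝ≥0∞)
    (h₁ : ∀ i, Measurable (g₁ i)) (h₂ : ∀ i, Measurable (g₂ i)) (h₃ : ∀ i j, Measurable (g₃ i j))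
    (h₄ : ∀ i j i' j', Measurable (g₄ i j i' j')) :
    ∫⁻ p, a * ((∑ i, g₁ i p) + (∑ j, g₂ j p) + (∑ i, ∑ j, g₃ i j p) +
      b * ∑ i, ∑ j, ∑ i', ∑ j', g₄ i j i' j' p) ∂μ =
    a * ((∑ i, ∫⁻ p, g₁ i p ∂μ) + (∑ j, ∫⁻ p, g₂ j p ∂μ) + (∑ i, ∑ j, ∫⁻ p, g₃ i j p ∂μ) +
      b * ∑ i, ∑ j, ∑ i', ∑ j', ∫⁻ p, g₄ i j i' j' p ∂μ) := by
  have m1 : Measurable fun p => ∑ i, g₁ i p := Finset.measurable_fun_sum _ fun i _ => h₁ i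
  have m2 : Measurable fun p => ∑ i, g₂ i p := Finset.measurable_fun_sum _ fun i _ => h₂ i
  have m3' : ∀ i, Measurable fun p => ∑ j, g₃ i j p := fun i =>
    Finset.measurable_fun_sum _ fun j _ => h₃ i j
  have m3 : Measurable fun p => ∑ i, ∑ j, g₃ i j p := Finset.measurable_fun_sum _ fun i _ => m3' i
  have m4a : ∀ i j i', Measurable fun p => ∑ j', g₄ i j i' j' p := fun i j i' =>
    Finset.measurable_fun_sum _ fun j' _ => h₄ i j i' j'
  have m4b : ∀ i j, Measurable fun p => ∑ i', ∑ j', g₄ i j i' j' p := fun i j =>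
    Finset.measurable_fun_sum _ fun i' _ => m4a i j i'
  have m4c : ∀ i, Measurable fun p => ∑ j, ∑ i', ∑ j', g₄ i j i' j' p := fun i =>
    Finset.measurable_fun_sum _ fun j _ => m4b i j
  have m12 : Measurable fun p => ∑ i, g₁ i p + ∑ i, g₂ i p := m1.add m2
  have m123 : Measurable fun p => ∑ i, g₁ i p + ∑ i, g₂ i p + ∑ i, ∑ j, g₃ i j p := m12.add m3
  rw [lintegral_const_mul' _ _ ha, lintegral_add_left m123,
    lintegral_add_left m12, lintegral_add_left m1, lintegral_const_mul' _ _ hb,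
    lintegral_finsetSum _ (fun i _ => h₁ i), lintegral_finsetSum _ (fun i _ => h₂ i),
    lintegral_finsetSum _ (fun i _ => m3' i), lintegral_finsetSum _ (fun i _ => m4c i)]
  congr 2
  · congr 1
    exact Finset.sum_congr rfl fun i _ => lintegral_finsetSum _ (fun j _ => h₃ i j)
  · congr 1
    refine Finset.sum_congr rfl fun i _ => ?_
    rw [lintegral_finsetSum _ (fun j _ => m4b i j)]
    refine Finset.sum_congr rfl fun j _ => ?_
    rw [lintegral_finsetSum _ (fun i' _ => m4a i j i')]
    refine Finset.sum_congr rfl fun i' _ => ?_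
    rw [lintegral_finsetSum _ (fun j' _ => h₄ i j i' j')]

set_option maxHeartbeats 1000000 in
open Classical in
lemma linear_step (s r r₁ C : ℝ) (hs₁ : 3 / 2 < s) (hr : r < r₁) (hr₁ : 0 < r₁)
    (hr₁' : r₁ < s / (s - 1)) (hBH : BH s r C) (n : ℕ) (hn : 2 ≤ n) :
    ∃ K : ℝ≥0∞, K ≠ ⊤ ∧ ∀ (R : ℝ) (V : ℝ≥0∞),
      (∀ A' : Set (ℝ × ℝ), MeasurableSet A' → A' ⊆ Ico 0 1 ×ˢ Ico 0 1 →
        ∫⁻ p in DR R, ‖extOp (chi A') p‖ₑ ^ (2 * s) ≤ V) →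
      ∀ A : Set (ℝ × ℝ), MeasurableSet A → A ⊆ Ico 0 1 ×ˢ Ico 0 1 →
        ∫⁻ p in DR R, ‖extOp (chi A) p‖ₑ ^ (2 * s) ≤
          36 ^ (2 * s) * (3 * (ENNReal.ofReal ((n : ℝ) ^ (3 - 2 * s)) * V) + K) := by
  have hs0 : 0 < s := by linarith
  have hq : 0 < 2 * s := by linarith
  have hn' : (2 : ℝ) ≤ n := by exact_mod_cast hn
  have hnp : (0 : ℝ) < n := by linarith
  set K₀ : ℝ≥0∞ := (ENNReal.ofReal C *
    ENNReal.ofReal ((1 / (n : ℝ) * (1 / n)) ^ (2 * (1 - 1 / s) - 2 * (1 / r₁)))) ^ s with hK₀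
  have hK₀t : K₀ ≠ ⊤ := by rw [hK₀]; finiteness
  refine ⟨((n : ℝ≥0∞) * n) ^ (2 * s) * ∑ _i : Fin n, ∑ _j : Fin n, ∑ _i' : Fin n, ∑ _j' : Fin n, K₀,
    ?_, ?_⟩
  · refine ENNReal.mul_ne_top (by finiteness) ?_
    simp only [ENNReal.sum_ne_top]
    exact fun _ _ _ _ _ _ _ _ => hK₀t
  intro R V hV A hA hAs
  have fin : ∀ B ⊆ A, volume B ≠ ⊤ := by
    intro B hB
    refine ne_top_of_rect (a := 0) (b := 0) (w := 1) (h := 1) (by norm_num) ((hB.trans hAs).trans ?_)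
    simp only [zero_add]
    exact prod_mono Ico_subset_Icc_self Ico_subset_Icc_self
  have vle : ∀ B ⊆ A, volume B ≤ 1 := by
    intro B hB
    refine (measure_mono ((hB.trans hAs).trans
      (prod_mono Ico_subset_Icc_self Ico_subset_Icc_self))).trans ?_
    have := vol_rect 0 0 1 1 (by norm_num)
    simp only [zero_add] at this
    rw [this]; simp
  set cl : Fin n → Set (ℝ × ℝ) := fun i => A ∩ (gr n i ×ˢ univ) with hcl
  set rw' : Fin n → Set (ℝ × ℝ) := fun j => A ∩ (univ ×ˢ gr n j) with hrw
  set ce : Fin n → Fin n → Set (ℝ × ℝ) := fun i j => A ∩ (gr n i ×ˢ gr n j) with hce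
  have mcl : ∀ i, MeasurableSet (cl i) := fun i =>
    hA.inter ((gr_meas n i).prod MeasurableSet.univ)
  have mrw : ∀ i, MeasurableSet (rw' i) := fun i =>
    hA.inter (MeasurableSet.univ.prod (gr_meas n i))
  have mce : ∀ i j, MeasurableSet (ce i j) := fun i j =>
    hA.inter ((gr_meas n i).prod (gr_meas n j))
  have e1 : ∀ p, extOp (chi A) p = ∑ i, extOp (chi (cl i)) p := by
    intro p
    rw [← extOp_biUnion Finset.univ cl mcl ?_ (fun i => fin _ inter_subset_left)]
    · congr 2
      ext ξ
      simp only [hcl, Finset.mem_univ, iUnion_true, mem_iUnion, mem_inter_iff, mem_prod, mem_univ,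
        and_true, exists_and_left, iff_self_and]
      intro h
      exact gr_cover n (by omega) _ (hAs h).1
    · intro i j hij
      rw [Set.disjoint_left]
      rintro ξ ⟨_, h1⟩ ⟨_, h2⟩
      exact Set.disjoint_left.1 (gr_disj n i j hij) h1.1 h2.1
  have e2 : ∀ i p, extOp (chi (cl i)) p = ∑ j, extOp (chi (ce i j)) p := by
    intro i p
    rw [← extOp_biUnion Finset.univ (ce i) (mce i) ?_ (fun i => fin _ inter_subset_left)]
    · congr 2
      ext ξ
      simp only [hcl, hce, Finset.mem_univ, iUnion_true, mem_iUnion, mem_inter_iff, mem_prod,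
        mem_univ, and_true, exists_and_left, and_congr_right_iff, iff_self_and]
      intro h _
      exact gr_cover n (by omega) _ (hAs h).2
    · intro i j hij
      rw [Set.disjoint_left]
      rintro ξ ⟨_, h1⟩ ⟨_, h2⟩
      exact Set.disjoint_left.1 (gr_disj n i j hij) h1.2 h2.2
  have e3 : ∀ j p, extOp (chi (rw' j)) p = ∑ i, extOp (chi (ce i j)) p := by
    intro j p
    rw [← extOp_biUnion Finset.univ (fun i => ce i j) (fun i => mce i j) ?_
      (fun i => fin _ inter_subset_left)]
    · congr 2
      ext ξ
      simp only [hrw, hce, Finset.mem_univ, iUnion_true, mem_iUnion, mem_inter_iff, mem_prod,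
        mem_univ, true_and, exists_and_left, exists_and_right, and_congr_right_iff, iff_and_self]
      intro h _
      exact gr_cover n (by omega) _ (hAs h).1
    · intro i j hij
      rw [Set.disjoint_left]
      rintro ξ ⟨_, h1⟩ ⟨_, h2⟩
      exact Set.disjoint_left.1 (gr_disj n i j hij) h1.1 h2.1
  have Mcl : ∀ i, Measurable (extOp (chi (cl i))) := fun i =>
    extOp_meas _ (mcl i) (fin _ inter_subset_left)
  have Mrw : ∀ i, Measurable (extOp (chi (rw' i))) := fun i =>
    extOp_meas _ (mrw i) (fin _ inter_subset_left)
  have Mce : ∀ i j, Measurable (extOp (chi (ce i j))) := fun i j =>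
    extOp_meas _ (mce i j) (fin _ inter_subset_left)
  -- bounds for the pieces
  have gri : ∀ i : Fin n, |(i : ℝ) / n| ≤ 1 := by
    intro i
    rw [abs_of_nonneg (by positivity), div_le_one hnp]
    exact_mod_cast i.2.le
  have hn1 : 1 / (n : ℝ) ≤ 1 / 2 := one_div_le_one_div_of_le (by norm_num) hn'
  have hn1p : 0 < 1 / (n : ℝ) := by positivity
  have ls : ∀ (u₁ u₂ l₁ l₂ : ℝ) (B : Set (ℝ × ℝ)), |u₁| ≤ 1 → |u₂| ≤ 1 → 0 < l₁ → 0 < l₂ →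
      l₁ ≤ 1 → l₂ ≤ 1 → l₁ * l₂ ≤ 1 / 2 → MeasurableSet B →
      B ⊆ Ico u₁ (u₁ + l₁) ×ˢ Ico u₂ (u₂ + l₂) →
      ∫⁻ p in DR R, ‖extOp (chi B) p‖ₑ ^ (2 * s) ≤
        ENNReal.ofReal ((l₁ * l₂) ^ (2 * s - 2)) * V := by
    intro u₁ u₂ l₁ l₂ B a1 a2 a3 a4 a5 a6 a7 a8 a9
    exact lin_scale u₁ u₂ l₁ l₂ _ a3 a4 hq B a8 a9 _ _ (DR_meas R) (DR_meas R)
      (DR_phi R u₁ u₂ l₁ l₂ a1 a2 a3 a4 a5 a6 a7) V hV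
  have bcl : ∀ i, ∫⁻ p in DR R, ‖extOp (chi (cl i)) p‖ₑ ^ (2 * s) ≤
      ENNReal.ofReal ((1 / (n : ℝ)) ^ (2 * s - 2)) * V := by
    intro i
    have := ls (i / n) 0 (1 / n) 1 (cl i) (gri i) (by simp) hn1p one_pos (by linarith) le_rfl
      (by linarith) (mcl i) (by
        rintro ξ ⟨h1, h2⟩
        exact ⟨h2.1, by simpa using (hAs h1).2⟩)
    simpa using this
  have brw : ∀ i, ∫⁻ p in DR R, ‖extOp (chi (rw' i)) p‖ₑ ^ (2 * s) ≤
      ENNReal.ofReal ((1 / (n : ℝ)) ^ (2 * s - 2)) * V := by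
    intro i
    have := ls 0 (i / n) 1 (1 / n) (rw' i) (by simp) (gri i) one_pos hn1p le_rfl (by linarith)
      (by linarith) (mrw i) (by
        rintro ξ ⟨h1, h2⟩
        exact ⟨by simpa using (hAs h1).1, h2.2⟩)
    simpa using this
  have bce : ∀ i j, ∫⁻ p in DR R, ‖extOp (chi (ce i j)) p‖ₑ ^ (2 * s) ≤
      ENNReal.ofReal ((1 / (n : ℝ) * (1 / n)) ^ (2 * s - 2)) * V := by
    intro i j
    exact ls (i / n) (j / n) (1 / n) (1 / n) (ce i j) (gri i) (gri j) hn1p hn1p (by linarith)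
      (by linarith) (by nlinarith) (mce i j) (by rintro ξ ⟨h1, h2⟩; exact h2)
  have bfar : ∀ i j i' j', ∫⁻ p in DR R, (if farI i i' ∧ farI j j' then
      ‖extOp (chi (ce i j)) p * extOp (chi (ce i' j')) p‖ₑ ^ s else 0) ≤ K₀ := by
    intro i j i' j'
    by_cases h : farI i i' ∧ farI j j'
    · simp only [h, and_self, if_true]
      have := bh_rect s r r₁ C hs₁ hr hr₁ hr₁' hBH (i / n) (j / n) (i' / n) (j' / n) (1 / n) (1 / n)
        hn1p hn1p (far_gr n i i' h.1) (far_gr n j j' h.2) (ce i j) (ce i' j') (mce i j) (mce i' j')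
        (by rintro ξ ⟨_, h2⟩; exact prod_mono Ico_subset_Icc_self Ico_subset_Icc_self h2)
        (by rintro ξ ⟨_, h2⟩; exact prod_mono Ico_subset_Icc_self Ico_subset_Icc_self h2)
      rw [eLpNorm_eq_lintegral_rpow_enorm_toReal (by simpa using hs0) ENNReal.ofReal_ne_top,
        ENNReal.toReal_ofReal hs0.le] at this
      have h2 : (∫⁻ p, ‖extOp (chi (ce i j)) p * extOp (chi (ce i' j')) p‖ₑ ^ s) ^ (1 / s) ≤
          ENNReal.ofReal C *
            ENNReal.ofReal ((1 / (n : ℝ) * (1 / n)) ^ (2 * (1 - 1 / s) - 2 * (1 / r₁))) := by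
        refine this.trans ?_
        calc _ ≤ ENNReal.ofReal C *
            ENNReal.ofReal ((1 / (n : ℝ) * (1 / n)) ^ (2 * (1 - 1 / s) - 2 * (1 / r₁)))
              * 1 ^ (1 / r₁) * 1 ^ (1 / r₁) := by
              gcongr <;> exact vle _ inter_subset_left
          _ = _ := by simp
      calc _ ≤ ∫⁻ p, ‖extOp (chi (ce i j)) p * extOp (chi (ce i' j')) p‖ₑ ^ s :=
            setLIntegral_le_lintegral _ _
        _ = ((∫⁻ p, ‖extOp (chi (ce i j)) p * extOp (chi (ce i' j')) p‖ₑ ^ s) ^ (1 / s)) ^ s := by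
            rw [← ENNReal.rpow_mul, one_div_mul_cancel hs0.ne', ENNReal.rpow_one]
        _ ≤ _ := by rw [hK₀]; gcongr
    · simp only [h, if_false]; simp
  have Mfar : ∀ i j i' j', Measurable (fun p => if farI i i' ∧ farI j j' then
      ‖extOp (chi (ce i j)) p * extOp (chi (ce i' j')) p‖ₑ ^ s else 0) := by
    intro i j i' j'
    by_cases h : farI i i' ∧ farI j j'
    · simp only [h, and_self, if_true]
      exact (((Mce i j).mul (Mce i' j')).enorm).pow_const s
    · simp only [h, if_false]; exact measurable_const
  have c1 : (n : ℝ) * (1 / (n : ℝ)) ^ (2 * s - 2) = (n : ℝ) ^ (3 - 2 * s) := by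
    rw [one_div, Real.inv_rpow hnp.le, ← Real.rpow_neg hnp.le]
    nth_rewrite 1 [← Real.rpow_one (n : ℝ)]
    rw [← Real.rpow_add hnp]; congr 1; ring
  have c2 : (n : ℝ) * ((n : ℝ) * (1 / (n : ℝ) * (1 / n)) ^ (2 * s - 2)) ≤ (n : ℝ) ^ (3 - 2 * s) := by
    rw [Real.mul_rpow hn1p.le hn1p.le]
    have : (n : ℝ) * ((n : ℝ) * ((1 / (n : ℝ)) ^ (2 * s - 2) * (1 / (n : ℝ)) ^ (2 * s - 2))) =
      (n * (1 / (n : ℝ)) ^ (2 * s - 2)) * (n * (1 / (n : ℝ)) ^ (2 * s - 2)) := by ring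
    rw [this, c1]
    refine mul_le_of_le_one_left (by positivity) ?_
    exact Real.rpow_le_one_of_one_le_of_nonpos (by linarith) (by linarith)
  have S1 : ∑ i : Fin n, ENNReal.ofReal ((1 / (n : ℝ)) ^ (2 * s - 2)) * V =
      ENNReal.ofReal ((n : ℝ) ^ (3 - 2 * s)) * V := by
    simp only [Finset.sum_const, Finset.card_univ, Fintype.card_fin, nsmul_eq_mul]
    rw [← mul_assoc, ← c1, ENNReal.ofReal_mul hnp.le, ENNReal.ofReal_natCast]
  have S2 : ∑ i : Fin n, ∑ j : Fin n,
      ENNReal.ofReal ((1 / (n : ℝ) * (1 / n)) ^ (2 * s - 2)) * V ≤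
      ENNReal.ofReal ((n : ℝ) ^ (3 - 2 * s)) * V := by
    simp only [Finset.sum_const, Finset.card_univ, Fintype.card_fin, nsmul_eq_mul]
    rw [← mul_assoc, ← mul_assoc]
    gcongr
    refine le_trans (le_of_eq ?_) (ENNReal.ofReal_le_ofReal c2)
    rw [ENNReal.ofReal_mul hnp.le, ENNReal.ofReal_mul hnp.le, ENNReal.ofReal_natCast, mul_assoc]
  calc ∫⁻ p in DR R, ‖extOp (chi A) p‖ₑ ^ (2 * s)
      ≤ ∫⁻ p in DR R, 36 ^ (2 * s) *
      ((∑ i, ‖extOp (chi (cl i)) p‖ₑ ^ (2 * s)) + (∑ j, ‖extOp (chi (rw' j)) p‖ₑ ^ (2 * s)) +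
        (∑ i, ∑ j, ‖extOp (chi (ce i j)) p‖ₑ ^ (2 * s)) +
        ((n : ℝ≥0∞) * n) ^ (2 * s) * ∑ i, ∑ j, ∑ i', ∑ j',
          if farI i i' ∧ farI j j' then
            ‖extOp (chi (ce i j)) p * extOp (chi (ce i' j')) p‖ₑ ^ s else 0) := by
        refine lintegral_mono fun p => ?_
        have := pw s hs0 n (fun i j => extOp (chi (ce i j)) p)
        simp only [← e2, ← e3, ← e1] at this
        exact this
    _ = 36 ^ (2 * s) *
      ((∑ i, ∫⁻ p in DR R, ‖extOp (chi (cl i)) p‖ₑ ^ (2 * s)) +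
        (∑ j, ∫⁻ p in DR R, ‖extOp (chi (rw' j)) p‖ₑ ^ (2 * s)) +
        (∑ i, ∑ j, ∫⁻ p in DR R, ‖extOp (chi (ce i j)) p‖ₑ ^ (2 * s)) +
        ((n : ℝ≥0∞) * n) ^ (2 * s) * ∑ i, ∑ j, ∑ i', ∑ j', ∫⁻ p in DR R,
          if farI i i' ∧ farI j j' then
            ‖extOp (chi (ce i j)) p * extOp (chi (ce i' j')) p‖ₑ ^ s else 0) := by
        exact lint_expand _ _ (by finiteness) (by finiteness)
          (fun i p => ‖extOp (chi (cl i)) p‖ₑ ^ (2 * s))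
          (fun i p => ‖extOp (chi (rw' i)) p‖ₑ ^ (2 * s))
          (fun i j p => ‖extOp (chi (ce i j)) p‖ₑ ^ (2 * s))
          (fun i j i' j' p => if farI i i' ∧ farI j j' then
            ‖extOp (chi (ce i j)) p * extOp (chi (ce i' j')) p‖ₑ ^ s else 0)
          (fun i => (Mcl i).enorm.pow_const _) (fun i => (Mrw i).enorm.pow_const _)
          (fun i j => (Mce i j).enorm.pow_const _) Mfar
    _ ≤ 36 ^ (2 * s) *
      ((∑ i : Fin n, ENNReal.ofReal ((1 / (n : ℝ)) ^ (2 * s - 2)) * V) +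
        (∑ j : Fin n, ENNReal.ofReal ((1 / (n : ℝ)) ^ (2 * s - 2)) * V) +
        (∑ i : Fin n, ∑ j : Fin n, ENNReal.ofReal ((1 / (n : ℝ) * (1 / n)) ^ (2 * s - 2)) * V) +
        ((n : ℝ≥0∞) * n) ^ (2 * s) * ∑ i : Fin n, ∑ j : Fin n, ∑ i' : Fin n, ∑ j' : Fin n, K₀) := by
        gcongr with i _ j _ i _ j _ i _ j _ i' _ j' _
        · exact bcl _
        · exact brw _
        · exact bce _ _
        · exact bfar _ _ _ _
    _ ≤ _ := by
        rw [S1]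
        gcongr
        calc _ ≤ ENNReal.ofReal ((n : ℝ) ^ (3 - 2 * s)) * V + ENNReal.ofReal ((n : ℝ) ^ (3 - 2 * s)) * V
              + ENNReal.ofReal ((n : ℝ) ^ (3 - 2 * s)) * V := by gcongr
          _ = _ := by ring

lemma linear_est (s r r₁ C : ℝ) (hs₁ : 3 / 2 < s) (hr : r < r₁) (hr₁ : 0 < r₁)
    (hr₁' : r₁ < s / (s - 1)) (hBH : BH s r C) :
    ∃ V : ℝ≥0∞, V ≠ ⊤ ∧ ∀ A : Set (ℝ × ℝ), MeasurableSet A → A ⊆ Ico 0 1 ×ˢ Ico 0 1 →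
        ∫⁻ p, ‖extOp (chi A) p‖ₑ ^ (2 * s) ≤ V := by
  have hs0 : 0 < s := by linarith
  have hq : 0 < 2 * s := by linarith
  obtain ⟨n, hn2, hn⟩ : ∃ n : ℕ, 2 ≤ n ∧ (36 : ℝ) ^ (2 * s) * (3 * (n : ℝ) ^ (3 - 2 * s)) ≤ 1 / 2 := by
    have t1 : Filter.Tendsto (fun x : ℝ => x ^ (-(2 * s - 3))) Filter.atTop (nhds 0) :=
      tendsto_rpow_neg_atTop (by linarith)
    have t2 := (t1.comp (tendsto_natCast_atTop_atTop (R := ℝ))).const_mul ((36 : ℝ) ^ (2 * s) * 3)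
    rw [mul_zero] at t2
    have t3 := (t2.eventually (gt_mem_nhds (show (0 : ℝ) < 1 / 2 by norm_num))).and
      (Filter.eventually_ge_atTop 2)
    obtain ⟨n, h1, h2⟩ := t3.exists
    refine ⟨n, h2, ?_⟩
    simp only [Function.comp, neg_sub] at h1
    linarith
  obtain ⟨K, hK, hstep⟩ := linear_step s r r₁ C hs₁ hr hr₁ hr₁' hBH n hn2
  refine ⟨2 * (36 ^ (2 * s) * K), by finiteness, ?_⟩
  have main : ∀ (R : ℝ) (A : Set (ℝ × ℝ)), MeasurableSet A → A ⊆ Ico 0 1 ×ˢ Ico 0 1 →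
      ∫⁻ p in DR R, ‖extOp (chi A) p‖ₑ ^ (2 * s) ≤ 2 * (36 ^ (2 * s) * K) := by
    intro R
    set V : ℝ≥0∞ := ⨆ (A : Set (ℝ × ℝ)) (_ : MeasurableSet A) (_ : A ⊆ Ico 0 1 ×ˢ Ico 0 1),
      ∫⁻ p in DR R, ‖extOp (chi A) p‖ₑ ^ (2 * s) with hV
    have hle : ∀ A : Set (ℝ × ℝ), MeasurableSet A → A ⊆ Ico 0 1 ×ˢ Ico 0 1 →
        ∫⁻ p in DR R, ‖extOp (chi A) p‖ₑ ^ (2 * s) ≤ V := by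
      intro A h1 h2
      exact le_iSup_of_le A (le_iSup_of_le h1 (le_iSup_of_le h2 le_rfl))
    have hVt : V ≠ ⊤ := by
      refine ne_top_of_le_ne_top (DR_finite R) ?_
      refine iSup_le fun A => iSup_le fun h1 => iSup_le fun h2 => ?_
      calc _ ≤ ∫⁻ p in DR R, 1 := by
            refine lintegral_mono fun p => ?_
            have : ‖extOp (chi A) p‖ₑ ≤ 1 := by
              refine (extOp_enorm_le A h1 p).trans ((measure_mono (h2.trans
                (prod_mono Ico_subset_Icc_self Ico_subset_Icc_self))).trans ?_)
              have := vol_rect 0 0 1 1 (by norm_num)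
              simp only [zero_add] at this
              rw [this]; simp
            calc _ ≤ (1 : ℝ≥0∞) ^ (2 * s) := by gcongr
              _ = 1 := by simp
        _ = _ := by simp
    have hVle : V ≤ 36 ^ (2 * s) * (3 * (ENNReal.ofReal ((n : ℝ) ^ (3 - 2 * s)) * V) + K) :=
      iSup_le fun A => iSup_le fun h1 => iSup_le fun h2 => hstep R V hle A h1 h2
    have hco : (36 : ℝ≥0∞) ^ (2 * s) * (3 * ENNReal.ofReal ((n : ℝ) ^ (3 - 2 * s))) ≤ 1 / 2 := by
      have := ENNReal.ofReal_le_ofReal hn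
      rw [ENNReal.ofReal_mul (by positivity), ENNReal.ofReal_mul (by positivity),
        ← ENNReal.ofReal_rpow_of_pos (by norm_num)] at this
      simpa using this
    have h3 : V ≤ V / 2 + 36 ^ (2 * s) * K := by
      refine hVle.trans ?_
      rw [mul_add]
      gcongr
      calc _ = ((36 : ℝ≥0∞) ^ (2 * s) * (3 * ENNReal.ofReal ((n : ℝ) ^ (3 - 2 * s)))) * V := by ring
        _ ≤ 1 / 2 * V := by gcongr
        _ = V / 2 := by rw [one_div, ENNReal.div_eq_inv_mul]
    have h4 : V / 2 ≤ 36 ^ (2 * s) * K := by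
      have h5 : V / 2 + V / 2 ≤ V / 2 + 36 ^ (2 * s) * K := by rwa [ENNReal.add_halves]
      exact (ENNReal.add_le_add_iff_left (by finiteness)).1 h5
    intro A h1 h2
    refine (hle A h1 h2).trans ?_
    rw [← ENNReal.add_halves V, two_mul]
    gcongr
  intro A h1 h2
  have hun : (⋃ k : ℕ, DR k) = univ := by
    rw [eq_univ_iff_forall]
    rintro ⟨t, x, y⟩
    obtain ⟨k, hk⟩ := exists_nat_ge (|x| + |y| + 2 * |t|)
    have := abs_nonneg x
    have := abs_nonneg y
    exact mem_iUnion.2 ⟨k, by simp only; linarith, by simp only; linarith⟩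
  have hdir : Directed (· ⊆ ·) (fun k : ℕ => DR k) := by
    refine Monotone.directed_le fun k l hkl => ?_
    have : (k : ℝ) ≤ l := by exact_mod_cast hkl
    rintro p ⟨a, b⟩
    exact ⟨a.trans this, b.trans this⟩
  rw [← setLIntegral_univ, ← hun, setLIntegral_iUnion_of_directed _ hdir]
  exact iSup_le fun k => main k A h1 h2

lemma lin_rect (s r r₁ C : ℝ) (hs₁ : 3 / 2 < s) (hr : r < r₁) (hr₁ : 0 < r₁)
    (hr₁' : r₁ < s / (s - 1)) (hBH : BH s r C) :
    ∃ N : ℝ, 0 < N ∧ ∀ (u₁ u₂ w₁ w₂ : ℝ) (A : Set (ℝ × ℝ)), 0 < w₁ → 0 < w₂ → MeasurableSet A →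
      A ⊆ Icc u₁ (u₁ + w₁) ×ˢ Icc u₂ (u₂ + w₂) →
      eLpNorm (extOp (chi A)) (ENNReal.ofReal (2 * s)) volume ≤
        ENNReal.ofReal (N * (w₁ * w₂) ^ (1 - 1 / s)) := by
  have hs0 : 0 < s := by linarith
  have hq : 0 < 2 * s := by linarith
  obtain ⟨V, hV, h⟩ := linear_est s r r₁ C hs₁ hr hr₁ hr₁' hBH
  refine ⟨4 ^ (1 - 1 / s) * (V ^ (1 / (2 * s))).toReal + 1, by positivity, ?_⟩
  intro u₁ u₂ w₁ w₂ A h1 h2 mA sA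
  have key := lin_scale u₁ u₂ (2 * w₁) (2 * w₂) (2 * s) (by linarith) (by linarith) hq A mA
    (sA.trans (prod_mono (Icc_subset_Ico_right (by linarith)) (Icc_subset_Ico_right (by linarith))))
    univ univ MeasurableSet.univ MeasurableSet.univ (fun _ _ => mem_univ _) V
    (by simpa only [setLIntegral_univ] using h)
  rw [setLIntegral_univ] at key
  rw [eLpNorm_eq_lintegral_rpow_enorm_toReal (by simpa using hs0) ENNReal.ofReal_ne_top,
        ENNReal.toReal_ofReal hq.le]
  have hw : 0 < w₁ * w₂ := mul_pos h1 h2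
  have hVt : V ^ (1 / (2 * s)) ≠ ⊤ := by finiteness
  calc _ ≤ (ENNReal.ofReal ((2 * w₁ * (2 * w₂)) ^ (2 * s - 2)) * V) ^ (1 / (2 * s)) := by gcongr
    _ = ENNReal.ofReal (4 ^ (1 - 1 / s) * (w₁ * w₂) ^ (1 - 1 / s) * (V ^ (1 / (2 * s))).toReal) := by
      rw [ENNReal.mul_rpow_of_nonneg _ _ (by positivity),
        ENNReal.ofReal_rpow_of_nonneg (by positivity) (by positivity),
        ENNReal.ofReal_mul (by positivity), ENNReal.ofReal_toReal hVt]
      congr 2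
      rw [← Real.rpow_mul (by positivity), ← Real.mul_rpow (by positivity) hw.le]
      congr 1
      · ring
      · field_simp
    _ ≤ _ := by
      apply ENNReal.ofReal_le_ofReal
      have : 0 < (w₁ * w₂) ^ (1 - 1 / s) := by positivity
      nlinarith

/-! ### Bilinear estimate for two rectangles -/

/-- the bilinear quantity -/
noncomputable def Bn (s : ℝ) (A B : Set (ℝ × ℝ)) : ℝ≥0∞ :=
  eLpNorm (fun p => extOp (chi A) p * extOp (chi B) p) (ENNReal.ofReal s) volume

lemma Bn_comm (s : ℝ) (A B : Set (ℝ × ℝ)) : Bn s A B = Bn s B A := by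
  unfold Bn; simp_rw [mul_comm]

lemma Bn_empty (s : ℝ) (B : Set (ℝ × ℝ)) : Bn s ∅ B = 0 := by
  unfold Bn; simp [extOp_empty]

lemma Bn_holder (s : ℝ) (hs : 1 ≤ s) (A B : Set (ℝ × ℝ)) (hA : MeasurableSet A)
    (hB : MeasurableSet B) (fA : volume A ≠ ⊤) (fB : volume B ≠ ⊤) :
    Bn s A B ≤ eLpNorm (extOp (chi A)) (ENNReal.ofReal (2 * s)) volume *
      eLpNorm (extOp (chi B)) (ENNReal.ofReal (2 * s)) volume := by
  have : ENNReal.HolderTriple (ENNReal.ofReal (2 * s)) (ENNReal.ofReal (2 * s))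
      (ENNReal.ofReal s) := by
    constructor
    rw [← ENNReal.ofReal_inv_of_pos (by linarith), ← ENNReal.ofReal_inv_of_pos (by linarith),
      ← ENNReal.ofReal_add (by positivity) (by positivity)]
    congr 1
    field_simp; norm_num
  exact eLpNorm_smul_le_mul_eLpNorm (𝕜 := ℂ) (E := ℂ) (f := extOp (chi B)) (φ := extOp (chi A))
    (extOp_cont B hB fB).aestronglyMeasurable (extOp_cont A hA fA).aestronglyMeasurable

lemma Bn_split (s : ℝ) (hs : 1 ≤ s) (A B S : Set (ℝ × ℝ)) (hA : MeasurableSet A)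
    (hB : MeasurableSet B) (hS : MeasurableSet S) (fA : volume A ≠ ⊤) (fB : volume B ≠ ⊤) :
    Bn s A B ≤ Bn s (A ∩ S) B + Bn s (A \ S) B := by
  have f1 : volume (A ∩ S) ≠ ⊤ := ne_top_of_le_ne_top fA (measure_mono inter_subset_left)
  have f2 : volume (A \ S) ≠ ⊤ := ne_top_of_le_ne_top fA (measure_mono sdiff_subset)
  have e : (fun p => extOp (chi A) p * extOp (chi B) p) =
      (fun p => extOp (chi (A ∩ S)) p * extOp (chi B) p) +
        fun p => extOp (chi (A \ S)) p * extOp (chi B) p := by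
    ext p
    rw [Pi.add_apply, extOp_split A S hA hS fA, add_mul]
  unfold Bn
  rw [e]
  refine eLpNorm_add_le ?_ ?_ (by simpa using hs)
  · exact ((extOp_cont _ (hA.inter hS) f1).mul (extOp_cont B hB fB)).aestronglyMeasurable
  · exact ((extOp_cont _ (hA.diff hS) f2).mul (extOp_cont B hB fB)).aestronglyMeasurable

lemma Bn_cover {ι : Type*} (s : ℝ) (hs : 1 ≤ s) (T : Finset ι) (S : ι → Set (ℝ × ℝ))
    (hS : ∀ i, MeasurableSet (S i)) (B : Set (ℝ × ℝ))
    (hB : MeasurableSet B) (fB : volume B ≠ ⊤) (X : ℝ≥0∞) :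
    ∀ A : Set (ℝ × ℝ), MeasurableSet A → volume A ≠ ⊤ → A ⊆ ⋃ i ∈ T, S i →
    (∀ i ∈ T, ∀ A' ⊆ A, MeasurableSet A' → A' ⊆ S i → Bn s A' B ≤ X) →
    Bn s A B ≤ T.card * X := by
  classical
  induction T using Finset.induction_on with
  | empty =>
    intro A _ _ hA _
    have : A = ∅ := by simpa using hA
    rw [this, Bn_empty]; simp
  | insert i T hi ih =>
    intro A mA fA hA h
    refine (Bn_split s hs A B (S i) mA hB (hS i) fA fB).trans ?_
    have h1 := h i (Finset.mem_insert_self _ _) (A ∩ S i) inter_subset_left (mA.inter (hS i))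
      inter_subset_right
    have h2 := ih (A \ S i) (mA.diff (hS i))
      (ne_top_of_le_ne_top fA (measure_mono sdiff_subset)) (by
        rintro x ⟨hx, hx'⟩
        have := hA hx
        simp only [Finset.mem_insert, iUnion_iUnion_eq_or_left, mem_union] at this
        exact this.resolve_left hx')
      (fun j hj A' hA' m' s' => h j (Finset.mem_insert_of_mem hj) A' (hA'.trans sdiff_subset) m' s')
    rw [Finset.card_insert_of_notMem hi]
    push_cast
    rw [add_mul, one_mul, add_comm]
    gcongr

lemma slice_cover (u l x : ℝ) (M : ℕ) (hM : 1 ≤ M) (hl : 0 < l) (hx : x ∈ Icc u (u + M * l)) :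
    ∃ k ∈ Finset.range M, x ∈ Icc (u + k * l) (u + k * l + l) := by
  rcases lt_or_ge x (u + M * l) with h | h
  · have h0 : 0 ≤ (x - u) / l := div_nonneg (by linarith [hx.1]) hl.le
    refine ⟨⌊(x - u) / l⌋₊, ?_, ?_, ?_⟩
    · rw [Finset.mem_range, Nat.floor_lt h0, div_lt_iff₀ hl]; linarith
    · have := Nat.floor_le h0
      rw [le_div_iff₀ hl] at this; linarith
    · have := Nat.lt_floor_add_one ((x - u) / l)
      rw [div_lt_iff₀ hl] at this; linarith
  · obtain ⟨m, rfl⟩ : ∃ m, M = m + 1 := ⟨M - 1, by omega⟩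
    refine ⟨m, by simp, ?_, ?_⟩
    · push_cast at h; linarith
    · have := hx.2
      push_cast at this; linarith

/-- the property of linear estimates on rectangles -/
def LinProp (s N : ℝ) : Prop :=
  ∀ (u₁ u₂ w₁ w₂ : ℝ) (A : Set (ℝ × ℝ)), 0 < w₁ → 0 < w₂ → MeasurableSet A →
      A ⊆ Icc u₁ (u₁ + w₁) ×ˢ Icc u₂ (u₂ + w₂) →
      eLpNorm (extOp (chi A)) (ENNReal.ofReal (2 * s)) volume ≤
        ENNReal.ofReal (N * (w₁ * w₂) ^ (1 - 1 / s))

lemma bil_lin (s N : ℝ) (hs : 1 ≤ s) (hN : 0 < N) (hL : LinProp s N)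
    (u₁ u₂ v₁ v₂ α₁ α₂ β₁ β₂ : ℝ) (hα₁ : 0 < α₁) (hα₂ : 0 < α₂) (hβ₁ : 0 < β₁) (hβ₂ : 0 < β₂)
    (A B : Set (ℝ × ℝ)) (mA : MeasurableSet A) (mB : MeasurableSet B)
    (sA : A ⊆ Icc u₁ (u₁ + α₁) ×ˢ Icc u₂ (u₂ + α₂))
    (sB : B ⊆ Icc v₁ (v₁ + β₁) ×ˢ Icc v₂ (v₂ + β₂)) :
    Bn s A B ≤ ENNReal.ofReal (N ^ 2 * (α₁ * α₂ * (β₁ * β₂)) ^ (1 - 1 / s)) := by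
  refine (Bn_holder s hs A B mA mB (ne_top_of_rect hα₁.le sA) (ne_top_of_rect hβ₁.le sB)).trans ?_
  refine (mul_le_mul' (hL _ _ _ _ A hα₁ hα₂ mA sA) (hL _ _ _ _ B hβ₁ hβ₂ mB sB)).trans ?_
  rw [← ENNReal.ofReal_mul (by positivity),
    Real.mul_rpow (mul_pos hα₁ hα₂).le (mul_pos hβ₁ hβ₂).le]
  apply le_of_eq; congr 1; ring

lemma bil_rect (s r r₁ C N : ℝ) (hs₁ : 3 / 2 < s) (hr : r < r₁) (hr₁ : 0 < r₁)
    (hr₁' : r₁ < s / (s - 1)) (hBH : BH s r C) (hN : 0 < N) (hL : LinProp s N)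
    (u₁ u₂ v₁ v₂ α₁ α₂ β₁ β₂ : ℝ) (hα₁ : 0 < α₁) (hα₂ : 0 < α₂) (hβ₁ : 0 < β₁) (hβ₂ : 0 < β₂)
    (M : ℕ) (hM : 1 ≤ M) (hM₁ : α₁ ≤ β₁ / M) (hM₂ : β₂ ≤ α₂ / M)
    (A B : Set (ℝ × ℝ)) (mA : MeasurableSet A) (mB : MeasurableSet B)
    (sA : A ⊆ Icc u₁ (u₁ + α₁) ×ˢ Icc u₂ (u₂ + α₂))
    (sB : B ⊆ Icc v₁ (v₁ + β₁) ×ˢ Icc v₂ (v₂ + β₂)) :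
    Bn s A B ≤ ENNReal.ofReal ((2 * N ^ 2 * 8 ^ (1 - 1 / s) + |C|) *
      (α₁ * α₂ * (β₁ * β₂)) ^ (1 - 1 / s) *
      ((M : ℝ) ^ (-(1 - 1 / s)) + (M : ℝ) ^ (2 + 4 * (1 / r₁ - (1 - 1 / s))) *
        (α₁ / β₁ * (β₂ / α₂)) ^ (1 / r₁ - (1 - 1 / s)))) := by
  have hs : 1 ≤ s := by linarith
  have hMp : (0 : ℝ) < M := by exact_mod_cast hM
  set κ := 1 - 1 / s with hκ
  set γ := 1 / r₁ - κ with hγ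
  set ℓ₁ := β₁ / M with hℓ₁
  set ℓ₂ := α₂ / M with hℓ₂
  have ℓ₁p : 0 < ℓ₁ := by positivity
  have ℓ₂p : 0 < ℓ₂ := by positivity
  have Mℓ₁ : M * ℓ₁ = β₁ := by rw [hℓ₁]; field_simp
  have Mℓ₂ : M * ℓ₂ = α₂ := by rw [hℓ₂]; field_simp
  set P := α₁ * α₂ * (β₁ * β₂) with hP
  have hPp : 0 < P := by positivity
  set S₁ : Set (ℝ × ℝ) := Icc (u₁ - 4 * ℓ₁) (u₁ - 4 * ℓ₁ + 8 * ℓ₁) ×ˢ univ with hS₁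
  set S₂ : Set (ℝ × ℝ) := univ ×ˢ Icc (v₂ - 4 * ℓ₂) (v₂ - 4 * ℓ₂ + 8 * ℓ₂) with hS₂
  have mS₁ : MeasurableSet S₁ := measurableSet_Icc.prod MeasurableSet.univ
  have mS₂ : MeasurableSet S₂ := MeasurableSet.univ.prod measurableSet_Icc
  have fA : ∀ A' ⊆ A, volume A' ≠ ⊤ := fun A' h => ne_top_of_rect hα₁.le (h.trans sA)
  have fB : ∀ A' ⊆ B, volume A' ≠ ⊤ := fun A' h => ne_top_of_rect hβ₁.le (h.trans sB)
  -- near parts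
  have near₁ : Bn s (B ∩ S₁) A ≤ ENNReal.ofReal (N ^ 2 * 8 ^ κ * P ^ κ * (M : ℝ) ^ (-κ)) := by
    refine (bil_lin s N hs hN hL (u₁ - 4 * ℓ₁) v₂ u₁ u₂ (8 * ℓ₁) β₂ α₁ α₂ (by positivity) hβ₂ hα₁ hα₂
      (B ∩ S₁) A (mB.inter mS₁) mA ?_ sA).trans (le_of_eq ?_)
    · rintro ξ ⟨h1, h2⟩; exact ⟨h2.1, (sB h1).2⟩
    · congr 1
      have : 8 * ℓ₁ * β₂ * (α₁ * α₂) = 8 * P * (M : ℝ)⁻¹ := by rw [hP, hℓ₁]; field_simp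
      rw [this, Real.mul_rpow (by positivity) (by positivity), Real.mul_rpow (by positivity) hPp.le,
        Real.inv_rpow hMp.le, ← Real.rpow_neg hMp.le]
      ring
  have near₂ : Bn s (A ∩ S₂) (B \ S₁) ≤
      ENNReal.ofReal (N ^ 2 * 8 ^ κ * P ^ κ * (M : ℝ) ^ (-κ)) := by
    refine (bil_lin s N hs hN hL u₁ (v₂ - 4 * ℓ₂) v₁ v₂ α₁ (8 * ℓ₂) β₁ β₂ hα₁ (by positivity) hβ₁ hβ₂
      (A ∩ S₂) (B \ S₁) (mA.inter mS₂) (mB.diff mS₁) ?_ (sdiff_subset.trans sB)).trans (le_of_eq ?_)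
    · rintro ξ ⟨h1, h2⟩; exact ⟨(sA h1).1, h2.2⟩
    · congr 1
      have : α₁ * (8 * ℓ₂) * (β₁ * β₂) = 8 * P * (M : ℝ)⁻¹ := by rw [hP, hℓ₂]; field_simp
      rw [this, Real.mul_rpow (by positivity) (by positivity), Real.mul_rpow (by positivity) hPp.le,
        Real.inv_rpow hMp.le, ← Real.rpow_neg hMp.le]
      ring
  -- far part
  set X : ℝ≥0∞ := ENNReal.ofReal (|C| * ((ℓ₁ * ℓ₂) ^ (2 * κ - 2 * (1 / r₁)) * P ^ (1 / r₁))) with hX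
  have far : Bn s (A \ S₂) (B \ S₁) ≤ M * (M * X) := by
    have c1 := Bn_cover s hs (Finset.range M)
      (fun k : ℕ => univ ×ˢ Icc (u₂ + k * ℓ₂) (u₂ + k * ℓ₂ + ℓ₂))
      (fun k => MeasurableSet.univ.prod measurableSet_Icc) (B \ S₁) (mB.diff mS₁)
      (fB _ sdiff_subset) (M * X) (A \ S₂) (mA.diff mS₂) (fA _ sdiff_subset) (by
        rintro ξ ⟨h1, -⟩
        obtain ⟨k, hk, hk'⟩ := slice_cover u₂ ℓ₂ ξ.2 M hM ℓ₂p (by rw [Mℓ₂]; exact (sA h1).2)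
        exact mem_biUnion hk ⟨mem_univ _, hk'⟩)
    rw [Finset.card_range] at c1
    apply c1
    intro k _ A' hA' mA' sA'
    have c2 := Bn_cover s hs (Finset.range M)
      (fun k : ℕ => Icc (v₁ + k * ℓ₁) (v₁ + k * ℓ₁ + ℓ₁) ×ˢ univ)
      (fun k => measurableSet_Icc.prod MeasurableSet.univ) A' mA'
      (fA _ (hA'.trans sdiff_subset)) X (B \ S₁) (mB.diff mS₁) (fB _ sdiff_subset) (by
        rintro ξ ⟨h1, -⟩
        obtain ⟨k, hk, hk'⟩ := slice_cover v₁ ℓ₁ ξ.1 M hM ℓ₁p (by rw [Mℓ₁]; exact (sB h1).1)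
        exact mem_biUnion hk ⟨hk', mem_univ _⟩)
    rw [Finset.card_range] at c2
    rw [Bn_comm]
    apply c2
    intro i _ B' hB' mB' sB'
    rw [Bn_comm]
    rcases lt_or_ge |u₂ + k * ℓ₂ - v₂| (3 * ℓ₂) with hk | hk
    · have : A' = ∅ := by
        rw [eq_empty_iff_forall_notMem]
        intro ξ hξ
        have h1 := (hA' hξ).2
        have h2 := (sA' hξ).2
        rw [abs_lt] at hk
        apply h1
        exact ⟨mem_univ _, by linarith [h2.1], by linarith [h2.2]⟩
      rw [this, Bn_empty]; exact zero_le
    rcases lt_or_ge |u₁ - (v₁ + i * ℓ₁)| (3 * ℓ₁) with hi | hi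
    · have : B' = ∅ := by
        rw [eq_empty_iff_forall_notMem]
        intro ξ hξ
        have h1 := (hB' hξ).2
        have h2 := (sB' hξ).1
        rw [abs_lt] at hi
        apply h1
        exact ⟨⟨by linarith [h2.1], by linarith [h2.2]⟩, mem_univ _⟩
      rw [this, Bn_comm, Bn_empty]; exact zero_le
    have key := bh_rect s r r₁ C hs₁ hr hr₁ hr₁' hBH u₁ (u₂ + k * ℓ₂) (v₁ + i * ℓ₁) v₂ ℓ₁ ℓ₂ ℓ₁p ℓ₂p
      hi hk A' B' mA' mB' (by
        intro ξ hξ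
        have h1 := (sA (hA' hξ).1).1
        exact ⟨⟨h1.1, by linarith [h1.2]⟩, (sA' hξ).2⟩) (by
        intro ξ hξ
        have h1 := (sB (hB' hξ).1).2
        exact ⟨(sB' hξ).1, ⟨h1.1, by linarith [h1.2]⟩⟩)
    have vA' : volume A' ≤ ENNReal.ofReal (α₁ * α₂) := by
      rw [← vol_rect u₁ u₂ α₁ α₂ hα₁.le]
      exact measure_mono ((hA'.trans sdiff_subset).trans sA)
    have vB' : volume B' ≤ ENNReal.ofReal (β₁ * β₂) := by
      rw [← vol_rect v₁ v₂ β₁ β₂ hβ₁.le]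
      exact measure_mono ((hB'.trans sdiff_subset).trans sB)
    calc _ ≤ _ := key
      _ ≤ ENNReal.ofReal |C| * ENNReal.ofReal ((ℓ₁ * ℓ₂) ^ (2 * κ - 2 * (1 / r₁))) *
        ENNReal.ofReal (α₁ * α₂) ^ (1 / r₁) * ENNReal.ofReal (β₁ * β₂) ^ (1 / r₁) := by
          gcongr
          exact le_abs_self C
      _ = X := by
        rw [ENNReal.ofReal_rpow_of_nonneg (by positivity) (by positivity),
          ENNReal.ofReal_rpow_of_nonneg (by positivity) (by positivity),
          ← ENNReal.ofReal_mul (by positivity), ← ENNReal.ofReal_mul (by positivity),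
          ← ENNReal.ofReal_mul (by positivity), hX, hP,
          Real.mul_rpow (x := α₁ * α₂) (by positivity) (by positivity)]
        congr 1; ring
  have alg : (M : ℝ) * (M * (|C| * ((ℓ₁ * ℓ₂) ^ (2 * κ - 2 * (1 / r₁)) * P ^ (1 / r₁)))) =
      |C| * P ^ κ * ((M : ℝ) ^ (2 + 4 * γ) * (α₁ / β₁ * (β₂ / α₂)) ^ γ) := by
    have e1 : 2 * κ - 2 * (1 / r₁) = -2 * γ := by rw [hγ]; ring
    have e2 : 1 / r₁ = κ + γ := by rw [hγ]; ring
    have hxy : 0 < α₁ / β₁ * (β₂ / α₂) := by positivity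
    have hβα : 0 < β₁ * α₂ := by positivity
    have e3 : P = (β₁ * α₂) ^ (2 : ℝ) * (α₁ / β₁ * (β₂ / α₂)) := by
      rw [hP, Real.rpow_two]; field_simp
    have e4 : P ^ γ = (β₁ * α₂) ^ (2 * γ) * (α₁ / β₁ * (β₂ / α₂)) ^ γ := by
      rw [e3, Real.mul_rpow (by positivity) hxy.le, ← Real.rpow_mul hβα.le]
    have e5 : ℓ₁ * ℓ₂ = (β₁ * α₂) * (M : ℝ) ^ (-2 : ℝ) := by
      rw [hℓ₁, hℓ₂, Real.rpow_neg hMp.le, Real.rpow_two]; field_simp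
    have e6 : (ℓ₁ * ℓ₂) ^ (-2 * γ) = (β₁ * α₂) ^ (-(2 * γ)) * (M : ℝ) ^ (4 * γ) := by
      rw [e5, Real.mul_rpow hβα.le (by positivity), ← Real.rpow_mul hMp.le]
      congr 2 <;> ring
    have e7 : (β₁ * α₂) ^ (-(2 * γ)) * (β₁ * α₂) ^ (2 * γ) = 1 := by
      rw [← Real.rpow_add hβα]; simp
    rw [e1, e2, Real.rpow_add hPp, e4, e6, Real.rpow_add hMp, Real.rpow_two]
    calc _ = |C| * P ^ κ * ((M : ℝ) ^ 2 * (M : ℝ) ^ (4 * γ) * (α₁ / β₁ * (β₂ / α₂)) ^ γ) *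
          ((β₁ * α₂) ^ (-(2 * γ)) * (β₁ * α₂) ^ (2 * γ)) := by ring
      _ = _ := by rw [e7, mul_one]
  have far' : Bn s (A \ S₂) (B \ S₁) ≤
      ENNReal.ofReal (|C| * P ^ κ * ((M : ℝ) ^ (2 + 4 * γ) * (α₁ / β₁ * (β₂ / α₂)) ^ γ)) := by
    refine far.trans (le_of_eq ?_)
    rw [← alg, ENNReal.ofReal_mul hMp.le, ENNReal.ofReal_mul hMp.le, ENNReal.ofReal_natCast]
  calc Bn s A B = Bn s B A := Bn_comm _ _ _
    _ ≤ Bn s (B ∩ S₁) A + Bn s (B \ S₁) A :=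
        Bn_split s hs B A S₁ mB mA mS₁ (fB _ subset_rfl) (fA _ subset_rfl)
    _ ≤ Bn s (B ∩ S₁) A + (Bn s (A ∩ S₂) (B \ S₁) + Bn s (A \ S₂) (B \ S₁)) := by
        rw [Bn_comm s (B \ S₁) A]
        gcongr
        exact Bn_split s hs A (B \ S₁) S₂ mA (mB.diff mS₁) mS₂ (fA _ subset_rfl) (fB _ sdiff_subset)
    _ ≤ _ := by
        refine (add_le_add near₁ (add_le_add near₂ far')).trans ?_
        rw [← ENNReal.ofReal_add (by positivity) (by positivity),
          ← ENNReal.ofReal_add (by positivity) (by positivity)]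
        apply ENNReal.ofReal_le_ofReal
        have hC := abs_nonneg C
        have t1 : 0 ≤ |C| * P ^ κ * (M : ℝ) ^ (-κ) := by positivity
        have t2 : 0 ≤ 2 * N ^ 2 * 8 ^ κ * P ^ κ *
          ((M : ℝ) ^ (2 + 4 * γ) * (α₁ / β₁ * (β₂ / α₂)) ^ γ) := by positivity
        linarith

lemma tile_pair (s r r₁ C N : ℝ) (hs₁ : 3 / 2 < s) (hr : r < r₁) (hr₁ : 0 < r₁)
    (hr₁' : r₁ < s / (s - 1)) (hBH : BH s r C) (hN : 0 < N) (hL : LinProp s N) :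
    ∃ c₁ D : ℝ, 0 < c₁ ∧ 0 < D ∧ ∀ J K J' K' : ℝ, K ≤ K' → ∀ u₁ u₂ v₁ v₂ : ℝ,
      ∀ A B : Set (ℝ × ℝ), MeasurableSet A → MeasurableSet B →
      A ⊆ Icc u₁ (u₁ + 2 ^ (-J)) ×ˢ Icc u₂ (u₂ + 2 ^ (-K)) →
      B ⊆ Icc v₁ (v₁ + 2 ^ (-J')) ×ˢ Icc v₂ (v₂ + 2 ^ (-K')) →
      Bn s A B ≤ ENNReal.ofReal (D * 2 ^ (-(c₁ * (K' - K))) *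
        2 ^ (-(2 * (1 - 1 / s) * min (J + K) (J' + K')))) := by
  have hs : 1 ≤ s := by linarith
  have hκ0 : 0 < 1 - 1 / s := by
    rw [sub_pos, div_lt_one (by linarith)]; linarith
  have hγ0 : 0 < 1 / r₁ - (1 - 1 / s) := by
    have : 1 - 1 / s = 1 / (s / (s - 1)) := by
      have : s ≠ 0 := by linarith
      have : s - 1 ≠ 0 := by intro h; linarith
      field_simp
    rw [this, sub_pos]
    exact one_div_lt_one_div_of_lt hr₁ hr₁'
  have BL := bil_lin s N hs hN hL
  have BR := bil_rect s r r₁ C N hs₁ hr hr₁ hr₁' hBH hN hL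
  set κ := 1 - 1 / s with hκ
  set γ := 1 / r₁ - κ with hγ
  set θ := γ / (4 + 8 * γ) with hθ
  have hθ0 : 0 < θ := by positivity
  have hθ1 : θ ≤ 1 / 2 := by
    rw [hθ, div_le_iff₀ (by positivity)]; linarith
  have hθγ : θ * (2 + 4 * γ) = γ / 2 := by rw [hθ]; field_simp; ring
  set c₁ := min (κ / 2) (min (θ * κ) (γ / 2)) with hc₁
  have h1 : c₁ ≤ κ / 2 := min_le_left _ _
  have h2 : c₁ ≤ θ * κ := (min_le_right _ _).trans (min_le_left _ _)
  have h3 : c₁ ≤ γ / 2 := (min_le_right _ _).trans (min_le_right _ _)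
  have hc0 : 0 < c₁ := by simp only [hc₁, lt_min_iff]; refine ⟨?_, ?_, ?_⟩ <;> positivity
  set E := 2 * N ^ 2 * 8 ^ κ + |C| with hE
  have hE0 : 0 < E := by positivity
  refine ⟨c₁, N ^ 2 + E * (2 ^ κ + 1), hc0, by positivity, ?_⟩
  intro J K J' K' hK u₁ u₂ v₁ v₂ A B mA mB sA sB
  have two : ∀ x : ℝ, 0 < (2 : ℝ) ^ x := fun x => Real.rpow_pos_of_pos two_pos x
  have mono : ∀ x y : ℝ, x ≤ y → (2 : ℝ) ^ x ≤ 2 ^ y :=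
    fun x y h => Real.rpow_le_rpow_of_exponent_le one_le_two h
  have hP : ((2 : ℝ) ^ (-J) * 2 ^ (-K) * (2 ^ (-J') * 2 ^ (-K'))) ^ κ =
      2 ^ (-(κ * (J + K + J' + K'))) := by
    rw [← Real.rpow_add two_pos, ← Real.rpow_add two_pos, ← Real.rpow_add two_pos,
      ← Real.rpow_mul two_pos.le]
    congr 1; ring
  set b := K' - K with hb
  have hb0 : 0 ≤ b := by linarith
  have hmin : 2 * min (J + K) (J' + K') = J + K + J' + K' - |J + K - (J' + K')| := by
    rcases le_total (J + K) (J' + K') with h | h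
    · rw [min_eq_left h, abs_of_nonpos (by linarith)]; ring
    · rw [min_eq_right h, abs_of_nonneg (by linarith)]; ring
  rcases le_or_gt (b / 2) |J + K - (J' + K')| with hc | hc
  · refine (BL u₁ u₂ v₁ v₂ _ _ _ _ (two _) (two _) (two _) (two _) A B mA mB sA sB).trans ?_
    apply ENNReal.ofReal_le_ofReal
    rw [hP, mul_assoc, ← Real.rpow_add two_pos]
    refine mul_le_mul ?_ (mono _ _ ?_) (two _).le (by positivity)
    · have : 0 < E * (2 ^ κ + 1) := by positivity
      linarith
    · have e : 2 * κ * min (J + K) (J' + K') = κ * (J + K + J' + K' - |J + K - (J' + K')|) := by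
        rw [← hmin]; ring
      rw [e]
      have : c₁ * b ≤ κ * |J + K - (J' + K')| := by
        calc c₁ * b ≤ κ / 2 * b := by gcongr
          _ = κ * (b / 2) := by ring
          _ ≤ _ := by gcongr
      linarith
  · have hJ : b / 2 ≤ J - J' := by
      rw [abs_lt] at hc; linarith
    have one_le : (1 : ℝ) ≤ 2 ^ (θ * b) := Real.one_le_rpow one_le_two (by positivity)
    set M := ⌊(2 : ℝ) ^ (θ * b)⌋₊ with hMdef
    have hM : 1 ≤ M := Nat.le_floor (by simpa using one_le)
    have hMr : (1 : ℝ) ≤ M := by exact_mod_cast hM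
    have hMp : (0 : ℝ) < M := by linarith
    have hMu : (M : ℝ) ≤ 2 ^ (θ * b) := Nat.floor_le (two _).le
    have hMl : (2 : ℝ) ^ (θ * b - 1) ≤ M := by
      rw [Real.rpow_sub two_pos, Real.rpow_one]
      have := Nat.lt_floor_add_one ((2 : ℝ) ^ (θ * b))
      rw [← hMdef] at this
      linarith
    have hθb : θ * b ≤ b / 2 := by nlinarith
    have hM₁ : (2 : ℝ) ^ (-J) ≤ 2 ^ (-J') / M := by
      rw [le_div_iff₀ hMp]
      calc (2 : ℝ) ^ (-J) * M ≤ 2 ^ (-J) * 2 ^ (θ * b) := by gcongr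
        _ = 2 ^ (-J + θ * b) := (Real.rpow_add two_pos _ _).symm
        _ ≤ _ := mono _ _ (by linarith)
    have hM₂ : (2 : ℝ) ^ (-K') ≤ 2 ^ (-K) / M := by
      rw [le_div_iff₀ hMp]
      calc (2 : ℝ) ^ (-K') * M ≤ 2 ^ (-K') * 2 ^ (θ * b) := by gcongr
        _ = 2 ^ (-K' + θ * b) := (Real.rpow_add two_pos _ _).symm
        _ ≤ _ := mono _ _ (by linarith)
    refine (BR u₁ u₂ v₁ v₂ _ _ _ _ (two _) (two _) (two _) (two _) M hM hM₁ hM₂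
      A B mA mB sA sB).trans ?_
    apply ENNReal.ofReal_le_ofReal
    rw [hP]
    have q : ((2 : ℝ) ^ (-J) / 2 ^ (-J') * (2 ^ (-K') / 2 ^ (-K))) ^ γ =
        2 ^ (-(γ * (J - J' + b))) := by
      rw [← Real.rpow_sub two_pos, ← Real.rpow_sub two_pos, ← Real.rpow_add two_pos,
        ← Real.rpow_mul two_pos.le]
      congr 1; rw [hb]; ring
    rw [q]
    have t1 : (M : ℝ) ^ (-κ) ≤ 2 ^ κ * 2 ^ (-(c₁ * b)) := by
      calc (M : ℝ) ^ (-κ) ≤ (2 ^ (θ * b - 1)) ^ (-κ) :=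
            Real.rpow_le_rpow_of_nonpos (two _) hMl (by linarith)
        _ = 2 ^ (κ + -(θ * κ * b)) := by
            rw [← Real.rpow_mul two_pos.le]; congr 1; ring
        _ = 2 ^ κ * 2 ^ (-(θ * κ * b)) := Real.rpow_add two_pos _ _
        _ ≤ _ := by
            refine mul_le_mul_of_nonneg_left (mono _ _ ?_) (two _).le
            have : c₁ * b ≤ θ * κ * b := by gcongr
            linarith
    have t2 : (M : ℝ) ^ (2 + 4 * γ) * 2 ^ (-(γ * (J - J' + b))) ≤ 2 ^ (-(c₁ * b)) := by
      calc (M : ℝ) ^ (2 + 4 * γ) * 2 ^ (-(γ * (J - J' + b)))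
          ≤ (2 ^ (θ * b)) ^ (2 + 4 * γ) * 2 ^ (-(γ * b)) := by
            refine mul_le_mul (Real.rpow_le_rpow hMp.le hMu (by positivity)) (mono _ _ ?_)
              (two _).le (by positivity)
            have : 0 ≤ γ * (J - J') := mul_nonneg hγ0.le (by linarith)
            linarith
        _ = 2 ^ (-(γ / 2 * b)) := by
            rw [← Real.rpow_mul two_pos.le, ← Real.rpow_add two_pos]
            congr 1
            have : θ * b * (2 + 4 * γ) = γ / 2 * b := by rw [← hθγ]; ring
            rw [this]; ring
        _ ≤ _ := by
            refine mono _ _ ?_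
            have : c₁ * b ≤ γ / 2 * b := by gcongr
            linarith
    have t3 : (2 : ℝ) ^ (-(κ * (J + K + J' + K'))) ≤
        2 ^ (-(2 * κ * min (J + K) (J' + K'))) := by
      apply mono
      have e : 2 * κ * min (J + K) (J' + K') = κ * (J + K + J' + K' - |J + K - (J' + K')|) := by
        rw [← hmin]; ring
      rw [e]
      have : 0 ≤ κ * |J + K - (J' + K')| := by positivity
      linarith
    calc E * 2 ^ (-(κ * (J + K + J' + K'))) *
          ((M : ℝ) ^ (-κ) + (M : ℝ) ^ (2 + 4 * γ) * 2 ^ (-(γ * (J - J' + b))))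
        ≤ E * 2 ^ (-(2 * κ * min (J + K) (J' + K'))) *
          (2 ^ κ * 2 ^ (-(c₁ * b)) + 2 ^ (-(c₁ * b))) := by
          gcongr
      _ = (E * (2 ^ κ + 1)) * 2 ^ (-(c₁ * b)) * 2 ^ (-(2 * κ * min (J + K) (J' + K'))) := by ring
      _ ≤ _ := by
          gcongr
          have : 0 ≤ N ^ 2 := by positivity
          linarith

lemma vFiber_vol_meas {Ω : Set (ℝ × ℝ)} (mΩ : MeasurableSet Ω) :
    Measurable fun x => volume (vFiber Ω x) :=
  measurable_measure_prodMk_left mΩ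

lemma fiberPiece_meas {Ω : Set (ℝ × ℝ)} (mΩ : MeasurableSet Ω) (K : ℕ) :
    MeasurableSet (fiberPiece Ω K) := by
  have h : Measurable fun ξ : ℝ × ℝ => volume (vFiber Ω ξ.1) :=
    (vFiber_vol_meas mΩ).comp measurable_fst
  exact mΩ.inter ((measurableSet_le measurable_const h).inter
    (measurableSet_le h measurable_const))

lemma fiberPiece_vol {Ω : Set (ℝ × ℝ)} (mΩ : MeasurableSet Ω) (J K : ℕ)
    (hJ : (2 : ℝ≥0∞) ^ (-(J : ℤ) - 1) ≤ volume (Prod.fst '' fiberPiece Ω K)) :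
    ENNReal.ofReal (2 ^ (-((J : ℝ) + K + 2))) ≤ volume (fiberPiece Ω K) := by
  set a : ℝ≥0∞ := (2 : ℝ≥0∞) ^ (-(K : ℤ) - 1) with ha
  have key : a * volume (Prod.fst '' fiberPiece Ω K) ≤ volume (fiberPiece Ω K) := by
    have mP := fiberPiece_meas mΩ K
    set G : Set ℝ := {x | a ≤ volume (vFiber (fiberPiece Ω K) x)} with hG
    have sub : Prod.fst '' fiberPiece Ω K ⊆ G := by
      rintro x ⟨⟨x', y⟩, h, rfl⟩
      have e : vFiber (fiberPiece Ω K) x' = vFiber Ω x' := by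
        ext z
        exact ⟨fun hz => hz.1, fun hz => ⟨hz, h.2⟩⟩
      change a ≤ volume (vFiber (fiberPiece Ω K) x')
      rw [e]; exact h.2.1
    calc a * volume (Prod.fst '' fiberPiece Ω K) ≤ a * volume G := by gcongr
      _ ≤ ∫⁻ x, volume (vFiber (fiberPiece Ω K) x) :=
          mul_meas_ge_le_lintegral (vFiber_vol_meas mP) a
      _ = volume (fiberPiece Ω K) := by
          rw [Measure.volume_eq_prod, Measure.prod_apply mP]; rfl
  refine le_trans (le_of_eq ?_) ((mul_le_mul_right hJ a).trans key)
  rw [ha, ← ENNReal.zpow_add two_ne_zero ENNReal.ofNat_ne_top,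
    ← ENNReal.ofReal_rpow_of_pos two_pos, ← ENNReal.rpow_intCast, ENNReal.ofReal_ofNat]
  congr 1; push_cast; ring

lemma dyadicIcc_eq (n : ℕ) (m : ℤ) :
    dyadicIcc n m = Icc ((m : ℝ) * 2 ^ (-(n : ℝ))) ((m : ℝ) * 2 ^ (-(n : ℝ)) + 2 ^ (-(n : ℝ))) := by
  have : (2 : ℝ) ^ (-(n : ℤ)) = 2 ^ (-(n : ℝ)) := by
    rw [← Real.rpow_intCast]; push_cast; rfl
  unfold dyadicIcc
  rw [this, add_mul, one_mul]

lemma tile_meas (j k m m' : ℤ) : MeasurableSet (tile j k m m') :=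
  measurableSet_Icc.prod measurableSet_Icc

lemma pair_bound (s c₁ D C₁ C₂ δ : ℝ) (hs₁ : 3 / 2 < s) (hc₁ : 0 < c₁) (hD : 0 < D) (hC₁ : 0 < C₁)
    (hC₂ : 0 < C₂) (hδ : 0 < δ)
    (htp : ∀ J K J' K' : ℝ, K ≤ K' → ∀ u₁ u₂ v₁ v₂ : ℝ,
      ∀ A B : Set (ℝ × ℝ), MeasurableSet A → MeasurableSet B →
      A ⊆ Icc u₁ (u₁ + 2 ^ (-J)) ×ˢ Icc u₂ (u₂ + 2 ^ (-K)) →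
      B ⊆ Icc v₁ (v₁ + 2 ^ (-J')) ×ˢ Icc v₂ (v₂ + 2 ^ (-K')) →
      Bn s A B ≤ ENNReal.ofReal (D * 2 ^ (-(c₁ * (K' - K))) *
        2 ^ (-(2 * (1 - 1 / s) * min (J + K) (J' + K')))))
    (J K J' K' : ℕ) (hK : K ≤ K') (hsep : 4 * C₂ / (c₁ * Real.log 2) * Real.log δ⁻¹ ≤ (K' : ℝ) - K)
    (A B : Set (ℝ × ℝ)) (mA : MeasurableSet A) (mB : MeasurableSet B)
    (fA : volume A ≠ ⊤) (fB : volume B ≠ ⊤) (T T' : Finset (ℤ × ℤ))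
    (hT : (T.card : ℝ) ≤ C₁ * δ ^ (-C₂)) (hT' : (T'.card : ℝ) ≤ C₁ * δ ^ (-C₂))
    (sA : A ⊆ ⋃ p ∈ T, tile (J : ℤ) (K : ℤ) p.1 p.2)
    (sB : B ⊆ ⋃ p ∈ T', tile (J' : ℤ) (K' : ℤ) p.1 p.2)
    (V V' : ℝ≥0∞) (hV : ENNReal.ofReal (2 ^ (-((J : ℝ) + K + 2))) ≤ V)
    (hV' : ENNReal.ofReal (2 ^ (-((J' : ℝ) + K' + 2))) ≤ V') :
    Bn s A B ≤ ENNReal.ofReal (C₁ ^ 2 * D * 2 ^ (4 * (1 - 1 / s)) *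
        2 ^ (-(c₁ / 2 * ((K' : ℝ) - K)))) * max V V' ^ (2 * (1 - 1 / s)) := by
  have hs : 1 ≤ s := by linarith
  have hκ0 : 0 < 1 - 1 / s := by
    rw [sub_pos, div_lt_one (by linarith)]; linarith
  set κ := 1 - 1 / s with hκ
  have two : ∀ x : ℝ, 0 < (2 : ℝ) ^ x := fun x => Real.rpow_pos_of_pos two_pos x
  set b : ℝ := (K' : ℝ) - K with hb
  have hKr : (K : ℝ) ≤ K' := by exact_mod_cast hK
  have hb0 : 0 ≤ b := by linarith
  set m : ℝ := min ((J : ℝ) + K) (J' + K') with hm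
  set X : ℝ := D * 2 ^ (-(c₁ * b)) * 2 ^ (-(2 * κ * m)) with hX
  have hX0 : 0 < X := by positivity
  have step : Bn s A B ≤ T.card * (T'.card * ENNReal.ofReal X) := by
    refine Bn_cover s hs T (fun p => tile J K p.1 p.2) (fun p => tile_meas _ _ _ _) B mB fB _
      A mA fA sA ?_
    intro i _ A' hA' mA' sA'
    rw [Bn_comm]
    refine Bn_cover s hs T' (fun p => tile J' K' p.1 p.2) (fun p => tile_meas _ _ _ _) A' mA'
      (ne_top_of_le_ne_top fA (measure_mono hA')) _ B mB fB sB ?_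
    intro i' _ B' _ mB' sB'
    rw [Bn_comm]
    simp only [tile, dyadicIcc_eq] at sA' sB'
    exact htp J K J' K' hKr _ _ _ _ A' B' mA' mB' sA' sB'
  have hmax : ENNReal.ofReal (2 ^ (-(2 * κ * (m + 2)))) ≤ max V V' ^ (2 * κ) := by
    have h0 : ENNReal.ofReal (2 ^ (-(m + 2))) ≤ max V V' := by
      rcases le_total ((J : ℝ) + K) (J' + K') with h | h
      · rw [hm, min_eq_left h]; exact hV.trans (le_max_left _ _)
      · rw [hm, min_eq_right h]; exact hV'.trans (le_max_right _ _)
    calc ENNReal.ofReal (2 ^ (-(2 * κ * (m + 2))))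
        = ENNReal.ofReal (2 ^ (-(m + 2))) ^ (2 * κ) := by
          rw [ENNReal.ofReal_rpow_of_pos (two _), ← Real.rpow_mul two_pos.le]
          congr 2; ring
      _ ≤ _ := ENNReal.rpow_le_rpow h0 (by positivity)
  have hdel : (δ ^ (-C₂)) ^ 2 ≤ 2 ^ (c₁ / 2 * b) := by
    have l2 : 0 < Real.log 2 := Real.log_pos one_lt_two
    have e : (δ ^ (-C₂)) ^ 2 = Real.exp (2 * C₂ * Real.log δ⁻¹) := by
      rw [← Real.rpow_natCast, ← Real.rpow_mul hδ.le, Real.rpow_def_of_pos hδ, Real.log_inv]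
      congr 1; push_cast; ring
    rw [e, Real.rpow_def_of_pos two_pos]
    apply Real.exp_le_exp.mpr
    calc 2 * C₂ * Real.log δ⁻¹
        = Real.log 2 * (c₁ / 2 * (4 * C₂ / (c₁ * Real.log 2) * Real.log δ⁻¹)) := by
          field_simp; ring
      _ ≤ _ := by gcongr
  have hcard : (T.card : ℝ≥0∞) * (T'.card * ENNReal.ofReal X) ≤
      ENNReal.ofReal (C₁ ^ 2 * (δ ^ (-C₂)) ^ 2 * X) := by
    rw [← ENNReal.ofReal_natCast, ← ENNReal.ofReal_natCast, ← ENNReal.ofReal_mul (by positivity),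
      ← ENNReal.ofReal_mul (by positivity)]
    apply ENNReal.ofReal_le_ofReal
    calc (T.card : ℝ) * (T'.card * X) ≤ (C₁ * δ ^ (-C₂)) * ((C₁ * δ ^ (-C₂)) * X) := by
          gcongr
      _ = _ := by ring
  refine (step.trans hcard).trans ?_
  refine le_trans ?_ (mul_le_mul_right hmax _)
  rw [← ENNReal.ofReal_mul (by positivity)]
  apply ENNReal.ofReal_le_ofReal
  calc C₁ ^ 2 * (δ ^ (-C₂)) ^ 2 * X ≤ C₁ ^ 2 * 2 ^ (c₁ / 2 * b) * X := by gcongr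
    _ = C₁ ^ 2 * D * (2 ^ (c₁ / 2 * b) * 2 ^ (-(c₁ * b)) * 2 ^ (-(2 * κ * m))) := by rw [hX]; ring
    _ = C₁ ^ 2 * D * (2 ^ (4 * κ) * 2 ^ (-(c₁ / 2 * b)) * 2 ^ (-(2 * κ * (m + 2)))) := by
        rw [← Real.rpow_add two_pos, ← Real.rpow_add two_pos, ← Real.rpow_add two_pos,
          ← Real.rpow_add two_pos]
        congr 2; ring
    _ = _ := by ring

/-- bilinear estimate with decay between different fiber-length scales:
under BH(s,r) with `3/2 < s < 2`, `r < s'`, and given constants `C₁, C₂ > 0` quantifying the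
near-tile decomposition, there are admissible constants `A₀` (the required separation
constant), `c₀ > 0` and `C₃ > 0` such that the following holds.  With `Ω, ε, δ, J, Ω_δ(K)` as
in the decoupling setup, if `𝓚 ⊆ 𝓚(ε)` is such that both `𝓚` and `{J(K) : K ∈ 𝓚}` are
`A₀ log δ⁻¹`-separated, then for all `K, K' ∈ 𝓚`,
`∥𝓔χ_{Ω_δ(K)}·𝓔χ_{Ω_δ(K')}∥_{L^s} ≤ C₃ 2^{-c₀|K-K'|} max{|Ω(K)|,|Ω(K')|}^{2/s'}`. -/
theorem stmt11 (s r A C₁ C₂ : ℝ) (hs₁ : 3 / 2 < s) (hs₂ : s < 2) (hr : r < s / (s - 1))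
    (hBH : BH s r A) (hC₁ : 0 < C₁) (hC₂ : 0 < C₂) :
    ∃ A₀ c₀ C₃ : ℝ, 0 < A₀ ∧ 0 < c₀ ∧ 0 < C₃ ∧
      ∀ (Ω : Set (ℝ × ℝ)), MeasurableSet Ω → Ω ⊆ Icc 0 1 ×ˢ Icc 0 1 →
      ∀ (ε δ : ℝ), IsDyadic ε → IsDyadic δ → 0 < δ → δ ≤ ε →
      ∀ (J : ℕ → ℕ) (Ωδ : ℕ → Set (ℝ × ℝ)) (𝓚 : Set ℕ), 𝓚 ⊆ KsetOf s Ω ε →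
        (∀ K ∈ KsetOf s Ω ε,
          (2 : ℝ≥0∞) ^ (-(J K : ℤ) - 1) ≤ volume (Prod.fst '' fiberPiece Ω K) ∧
            volume (Prod.fst '' fiberPiece Ω K) ≤ (2 : ℝ≥0∞) ^ (-(J K : ℤ) + 1)) →
        (∀ K ∈ KsetOf s Ω ε, MeasurableSet (Ωδ K) ∧ Ωδ K ⊆ fiberPiece Ω K ∧
          (∃ T : Finset (ℤ × ℤ), (T.card : ℝ) ≤ C₁ * δ ^ (-C₂) ∧
            Ωδ K ⊆ ⋃ p ∈ T, tile (J K : ℤ) (K : ℤ) p.1 p.2) ∧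
          ∀ Ω' ⊆ Ωδ K, MeasurableSet Ω' →
            eLpNorm (extOp (chi Ω')) (ENNReal.ofReal (2 * s)) volume ≤
              ENNReal.ofReal (C₁ * δ) * volume (fiberPiece Ω K) ^ (1 - 1 / s)) →
        (∀ K ∈ 𝓚, ∀ K' ∈ 𝓚, K ≠ K' →
          A₀ * Real.log δ⁻¹ ≤ |(K : ℝ) - (K' : ℝ)| ∧
            A₀ * Real.log δ⁻¹ ≤ |(J K : ℝ) - (J K' : ℝ)|) →
        ∀ K ∈ 𝓚, ∀ K' ∈ 𝓚,
          eLpNorm (fun p => extOp (chi (Ωδ K)) p * extOp (chi (Ωδ K')) p)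
              (ENNReal.ofReal s) volume ≤
            ENNReal.ofReal (C₃ * 2 ^ (-(c₀ * |(K : ℝ) - (K' : ℝ)|))) *
              max (volume (fiberPiece Ω K)) (volume (fiberPiece Ω K')) ^ (2 * (1 - 1 / s)) := by
  have hs1 : 0 < s - 1 := by linarith
  have hκ0 : 0 < 1 - 1 / s := by
    rw [sub_pos, div_lt_one (by linarith)]; linarith
  have h2s : 2 < s / (s - 1) := by rw [lt_div_iff₀ hs1]; linarith
  obtain ⟨r₁, hr₁a, hr₁b⟩ := exists_between (max_lt hr h2s)
  have hrr : r < r₁ := (le_max_left _ _).trans_lt hr₁a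
  have hr₁0 : 0 < r₁ := two_pos.trans ((le_max_right _ _).trans_lt hr₁a)
  obtain ⟨N, hN, hL⟩ := lin_rect s r r₁ A hs₁ hrr hr₁0 hr₁b hBH
  obtain ⟨c₁, D, hc₁, hD, htp⟩ := tile_pair s r r₁ A N hs₁ hrr hr₁0 hr₁b hBH hN hL
  have l2 : 0 < Real.log 2 := Real.log_pos one_lt_two
  have two : ∀ x : ℝ, 0 < (2 : ℝ) ^ x := fun x => Real.rpow_pos_of_pos two_pos x
  set E₁ : ℝ := C₁ ^ 2 * D * 2 ^ (4 * (1 - 1 / s)) with hE₁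
  set E₂ : ℝ := (C₁ * C₁ ^ (1 / C₂)) ^ 2 with hE₂
  have hE₁0 : 0 < E₁ := by positivity
  have hE₂0 : 0 < E₂ := by positivity
  refine ⟨4 * C₂ / (c₁ * Real.log 2), c₁ / 2, E₁ + E₂, by positivity, by positivity,
    by positivity, ?_⟩
  intro Ω mΩ hΩ ε δ _ _ hδ _ J Ωδ 𝓚 h𝓚 hJ hpiece hsep K hK K' hK'
  have fin : ∀ L ∈ 𝓚, volume (Ωδ L) ≠ ⊤ := by
    intro L hL'
    have h := ((hpiece L (h𝓚 hL')).2.1.trans (fun ξ hξ => hξ.1)).trans hΩ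
    refine ne_top_of_rect (a := 0) (b := 0) (w := 1) (h := 1) zero_le_one ?_
    simpa using h
  have main : ∀ L ∈ 𝓚, ∀ L' ∈ 𝓚, L < L' → Bn s (Ωδ L) (Ωδ L') ≤
      ENNReal.ofReal ((E₁ + E₂) * 2 ^ (-(c₁ / 2 * |(L : ℝ) - (L' : ℝ)|))) *
        max (volume (fiberPiece Ω L)) (volume (fiberPiece Ω L')) ^ (2 * (1 - 1 / s)) := by
    intro L hL1 L' hL2 hlt
    obtain ⟨m1, -, ⟨T, hT, sT⟩, -⟩ := hpiece L (h𝓚 hL1)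
    obtain ⟨m2, -, ⟨T', hT', sT'⟩, -⟩ := hpiece L' (h𝓚 hL2)
    have hr' : (L : ℝ) < L' := by exact_mod_cast hlt
    have hab : |(L : ℝ) - (L' : ℝ)| = (L' : ℝ) - L := by
      rw [abs_of_neg (by linarith)]; ring
    have h1 := (hsep L hL1 L' hL2 hlt.ne).1
    rw [hab] at h1 ⊢
    refine (pair_bound s c₁ D C₁ C₂ δ hs₁ hc₁ hD hC₁ hC₂ hδ htp (J L) L (J L') L' hlt.le h1
      (Ωδ L) (Ωδ L') m1 m2 (fin L hL1) (fin L' hL2) T T' hT hT' sT sT' _ _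
      (fiberPiece_vol mΩ _ _ (hJ L (h𝓚 hL1)).1) (fiberPiece_vol mΩ _ _ (hJ L' (h𝓚 hL2)).1)).trans ?_
    refine mul_le_mul_left (ENNReal.ofReal_le_ofReal ?_) _
    refine mul_le_mul_of_nonneg_right ?_ (two _).le
    linarith
  change Bn s (Ωδ K) (Ωδ K') ≤ _
  rcases lt_trichotomy K K' with h | h | h
  · exact main K hK K' hK' h
  · subst h
    obtain ⟨m1, -, ⟨T, hT, sT⟩, hb⟩ := hpiece K (h𝓚 hK)
    rcases T.eq_empty_or_nonempty with hTe | hTn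
    · have : Ωδ K = ∅ := by
        rw [hTe] at sT; simpa using sT
      rw [this, Bn_empty]; exact zero_le
    have hcard : (1 : ℝ) ≤ T.card := by exact_mod_cast hTn.card_pos
    have h1 : δ ^ C₂ ≤ C₁ := by
      have := hcard.trans hT
      rw [Real.rpow_neg hδ.le, ← div_eq_mul_inv, le_div_iff₀ (by positivity)] at this
      linarith
    have h2 : δ ≤ C₁ ^ (1 / C₂) := by
      calc δ = (δ ^ C₂) ^ (1 / C₂) := by
            rw [← Real.rpow_mul hδ.le, mul_one_div_cancel hC₂.ne', Real.rpow_one]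
        _ ≤ _ := Real.rpow_le_rpow (by positivity) h1 (by positivity)
    have h3 := hb (Ωδ K) subset_rfl m1
    refine (Bn_holder s (by linarith) _ _ m1 m1 (fin K hK) (fin K hK)).trans ?_
    refine (mul_le_mul' h3 h3).trans ?_
    rw [max_self, sub_self, abs_zero, mul_zero, neg_zero, Real.rpow_zero, mul_one, two_mul,
      ENNReal.rpow_add_of_nonneg _ _ hκ0.le hκ0.le, mul_mul_mul_comm,
      ← ENNReal.ofReal_mul (by positivity)]
    refine mul_le_mul_left (ENNReal.ofReal_le_ofReal ?_) _
    calc C₁ * δ * (C₁ * δ) = (C₁ * δ) ^ 2 := by ring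
      _ ≤ E₂ := by rw [hE₂]; gcongr
      _ ≤ _ := by linarith
  · have := main K' hK' K hK h
    rw [Bn_comm, max_comm, abs_sub_comm]
    exact this
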